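/- arXiv:1903.03502 — 2 statements merged into one kernel-verified Lean document; each statement's English description precedes it below -/
import Mathlib

section
/- Let n ≥ 3 and let σ be a smooth asymptotically flat Riemannian metric on ℝⁿ. For any h > 0 and any r₁ > 0 there exist r₀ ≥ r₁ and a rotationally symmetric smooth function b : ℝⁿ∖B_{r₀}(0) → ℝ with the following properties: (i) b > 0; (ii) b(x) → 0 as |x| → ∞; (iii) b(x) ≥ h for |x| = r₀; (iv) g^{ij}(σ,∇b)(∇²_σ b)_{ij} ≤ 0, i.e. b is a static supersolution of the graphical mean curvature flow. -/
noncomputable section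
open Real Set Filter MeasureTheory Metric ENNReal

/-- Partial derivative of `f` at `x` in the `i`-th coordinate direction. -/
def pd {n : ℕ} (i : Fin n) (f : EuclideanSpace ℝ (Fin n) → ℝ) (x : EuclideanSpace ℝ (Fin n)) : ℝ :=
  fderiv ℝ f x (EuclideanSpace.single i 1)

/-- `|∇u|²_σ = σ^{ij} ∂_i u ∂_j u`. -/
def gradSq {n : ℕ} (σ : EuclideanSpace ℝ (Fin n) → Matrix (Fin n) (Fin n) ℝ)
    (u : EuclideanSpace ℝ (Fin n) → ℝ) (x : EuclideanSpace ℝ (Fin n)) : ℝ :=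
  ∑ i, ∑ j, (σ x)⁻¹ i j * pd i u x * pd j u x

/-- Christoffel symbols `Γ^k_{ij}` of the metric `σ`. -/
def christoffel {n : ℕ} (σ : EuclideanSpace ℝ (Fin n) → Matrix (Fin n) (Fin n) ℝ)
    (k i j : Fin n) (x : EuclideanSpace ℝ (Fin n)) : ℝ :=
  (1 / 2) * ∑ l, (σ x)⁻¹ k l *
    (pd j (fun y => σ y l i) x + pd i (fun y => σ y l j) x - pd l (fun y => σ y i j) x)

/-- Covariant Hessian `(∇²_σ u)_{ij} = ∂_i ∂_j u − Γ^k_{ij} ∂_k u`. -/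
def covHess {n : ℕ} (σ : EuclideanSpace ℝ (Fin n) → Matrix (Fin n) (Fin n) ℝ)
    (u : EuclideanSpace ℝ (Fin n) → ℝ) (i j : Fin n) (x : EuclideanSpace ℝ (Fin n)) : ℝ :=
  pd i (fun y => pd j u y) x - ∑ k, christoffel σ k i j x * pd k u x

/-- `g^{ij}(σ,∇u) = σ^{ij} + σ^{ik}σ^{jl}∂_k u ∂_l u/(1 − |∇u|²_σ)`. -/
def ginv {n : ℕ} (σ : EuclideanSpace ℝ (Fin n) → Matrix (Fin n) (Fin n) ℝ)
    (u : EuclideanSpace ℝ (Fin n) → ℝ) (i j : Fin n) (x : EuclideanSpace ℝ (Fin n)) : ℝ :=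
  (σ x)⁻¹ i j + (∑ k, ∑ l, (σ x)⁻¹ i k * (σ x)⁻¹ j l * pd k u x * pd l u x) / (1 - gradSq σ u x)

/-- Graphical mean curvature operator `g^{ij}(σ,∇u)(∇²_σ u)_{ij}`. -/
def mcfOp {n : ℕ} (σ : EuclideanSpace ℝ (Fin n) → Matrix (Fin n) (Fin n) ℝ)
    (u : EuclideanSpace ℝ (Fin n) → ℝ) (x : EuclideanSpace ℝ (Fin n)) : ℝ :=
  ∑ i, ∑ j, ginv σ u i j x * covHess σ u i j x

/-- `σ` is a smooth asymptotically flat Riemannian metric on ℝⁿ with data `(R₀, C, ω)`. -/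
def IsAsympFlat {n : ℕ} (σ : EuclideanSpace ℝ (Fin n) → Matrix (Fin n) (Fin n) ℝ)
    (R₀ C : ℝ) (ω : ℝ → ℝ) : Prop :=
  0 < R₀ ∧ 0 < C ∧
  (∀ i j, ContDiff ℝ (⊤ : ℕ∞) fun x => σ x i j) ∧
  (∀ x, (σ x).PosDef) ∧
  (∃ B, ∀ ξ, R₀ < ξ → 0 < ω ξ ∧ ω ξ ≤ B) ∧
  Tendsto ω atTop (nhds 0) ∧
  ∀ x : EuclideanSpace ℝ (Fin n), R₀ ≤ ‖x‖ →
    (∀ i j, |σ x i j - (1 : Matrix (Fin n) (Fin n) ℝ) i j| ≤ C * ω ‖x‖) ∧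
    (∀ i j k, |pd k (fun y => σ y i j) x| ≤ C * ω ‖x‖ / ‖x‖)

theorem abs_sum_le_mul {n : ℕ} {f : Fin n → ℝ} {c : ℝ} (hf : ∀ i, |f i| ≤ c) :
    |∑ i, f i| ≤ n * c := by
  refine (Finset.abs_sum_le_sum_abs _ _).trans ?_
  refine (Finset.sum_le_card_nsmul _ _ c fun i _ => hf i).trans ?_
  simp

theorem abs_one_apply_le {n : ℕ} (i j : Fin n) : |(1 : Matrix (Fin n) (Fin n) ℝ) i j| ≤ 1 := by
  rw [Matrix.one_apply]; split_ifs <;> simp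

/-- First partial derivatives of a power of the squared norm. -/
theorem pd_normSq_rpow {n : ℕ} (A p : ℝ) (i : Fin n) {x : EuclideanSpace ℝ (Fin n)}
    (hx : x ≠ 0) :
    pd i (fun y => A * (‖y‖ ^ 2) ^ p) x = 2 * p * A * (‖x‖ ^ 2) ^ (p - 1) * x i := by
  have hs : ‖x‖ ^ 2 ≠ 0 := by positivity
  have h1 : HasFDerivAt (fun y : EuclideanSpace ℝ (Fin n) => ‖y‖ ^ 2) (2 • innerSL ℝ x) x :=
    (hasStrictFDerivAt_norm_sq x).hasFDerivAt
  have h2 := (h1.rpow_const (p := p) (Or.inl hs)).const_mul A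
  rw [pd, h2.fderiv]
  simp [EuclideanSpace.inner_single_right]
  ring

/-- Second partial derivatives of a power of the squared norm. -/
theorem pd_pd_normSq_rpow {n : ℕ} (A p : ℝ) (i j : Fin n) {x : EuclideanSpace ℝ (Fin n)}
    (hx : x ≠ 0) :
    pd i (fun z => pd j (fun y => A * (‖y‖ ^ 2) ^ p) z) x =
      2 * p * A * (‖x‖ ^ 2) ^ (p - 1) *
        ((1 : Matrix (Fin n) (Fin n) ℝ) i j + 2 * (p - 1) * (x i * x j / ‖x‖ ^ 2)) := by
  have hs : ‖x‖ ^ 2 ≠ 0 := by positivity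
  have hev : (fun z => pd j (fun y => A * (‖y‖ ^ 2) ^ p) z) =ᶠ[nhds x]
      fun z => 2 * p * A * (‖z‖ ^ 2) ^ (p - 1) * z j := by
    filter_upwards [isOpen_ne.mem_nhds hx] with z hz
    exact pd_normSq_rpow A p j hz
  have h1 : HasFDerivAt (fun y : EuclideanSpace ℝ (Fin n) => ‖y‖ ^ 2) (2 • innerSL ℝ x) x :=
    (hasStrictFDerivAt_norm_sq x).hasFDerivAt
  have h2 := (h1.rpow_const (p := p - 1) (Or.inl hs)).const_mul (2 * p * A)
  have h3 : HasFDerivAt (fun z : EuclideanSpace ℝ (Fin n) => z j)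
      (EuclideanSpace.proj j : EuclideanSpace ℝ (Fin n) →L[ℝ] ℝ) x :=
    (EuclideanSpace.proj j : EuclideanSpace ℝ (Fin n) →L[ℝ] ℝ).hasFDerivAt
  have h4 : HasFDerivAt (fun z => 2 * p * A * (‖z‖ ^ 2) ^ (p - 1) * z j) _ x := h2.mul h3
  rw [pd, hev.fderiv_eq, h4.fderiv, Real.rpow_sub_one hs (p - 1)]
  simp [EuclideanSpace.inner_single_right, Matrix.one_apply, eq_comm]
  split_ifs <;> field_simp <;> ring

/-- Outside a large ball, an asymptotically flat metric has inverse close to the identity and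
small scaled first derivatives. -/
theorem IsAsympFlat.exists_close {n : ℕ}
    {σ : EuclideanSpace ℝ (Fin n) → Matrix (Fin n) (Fin n) ℝ} {R₀ C : ℝ} {ω : ℝ → ℝ}
    (hσ : IsAsympFlat σ R₀ C ω) {ε : ℝ} (hε : 0 < ε) :
    ∃ R, ∀ x : EuclideanSpace ℝ (Fin n), R ≤ ‖x‖ →
      (∀ i j, |(σ x)⁻¹ i j - (1 : Matrix (Fin n) (Fin n) ℝ) i j| ≤ ε) ∧
      ∀ i j k, |pd k (fun y => σ y i j) x| * ‖x‖ ≤ ε := by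
  obtain ⟨hR, -, -, -, -, hω, hb⟩ := hσ
  let L : Filter (EuclideanSpace ℝ (Fin n)) := comap norm atTop
  have hn : Tendsto (fun x : EuclideanSpace ℝ (Fin n) => ‖x‖) L atTop := tendsto_comap
  have hCω : Tendsto (fun x : EuclideanSpace ℝ (Fin n) => C * ω ‖x‖) L (nhds 0) := by
    simpa using (hω.comp hn).const_mul C
  have hlarge : ∀ᶠ x in L, R₀ ≤ ‖x‖ := hn.eventually_ge_atTop R₀
  have hσ1 : Tendsto σ L (nhds 1) := by
    refine tendsto_pi_nhds.2 fun i => tendsto_pi_nhds.2 fun j => ?_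
    rw [tendsto_iff_dist_tendsto_zero]
    refine squeeze_zero' (Eventually.of_forall fun _ => dist_nonneg) ?_ hCω
    filter_upwards [hlarge] with x hx
    exact (hb x hx).1 i j
  have hinv : Tendsto (fun x => (σ x)⁻¹) L (nhds 1) := by
    have hdet : Tendsto (fun x => (σ x).det) L (nhds 1) := by
      have := ((continuous_id.matrix_det (n := Fin n) (R := ℝ)).tendsto 1).comp hσ1
      simpa [Function.comp_def] using this
    have hadj : Tendsto (fun x => (σ x).adjugate) L (nhds 1) := by
      have := ((continuous_id.matrix_adjugate (n := Fin n) (R := ℝ)).tendsto 1).comp hσ1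
      simpa [Function.comp_def] using this
    have := (hdet.inv₀ one_ne_zero).smul hadj
    simpa [Matrix.inv_def] using this
  have hall : ∀ᶠ x in L,
      (∀ i j, |(σ x)⁻¹ i j - (1 : Matrix (Fin n) (Fin n) ℝ) i j| ≤ ε) ∧
      ∀ i j k, |pd k (fun y => σ y i j) x| * ‖x‖ ≤ ε := by
    refine Eventually.and ?_ ?_
    · refine eventually_all.2 fun i => eventually_all.2 fun j => ?_
      have hij := tendsto_pi_nhds.1 (tendsto_pi_nhds.1 hinv i) j
      exact hij.eventually (Metric.closedBall_mem_nhds _ hε)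
    · filter_upwards [hlarge, hCω.eventually (ge_mem_nhds hε)] with x hx hxε i j k
      have hpos : 0 < ‖x‖ := hR.trans_le hx
      have := (hb x hx).2 i j k
      rw [le_div_iff₀ hpos] at this
      exact this.trans hxε
  obtain ⟨s, hs, hsub⟩ := mem_comap.1 hall
  obtain ⟨R, hRs⟩ := mem_atTop_sets.1 hs
  exact ⟨R, fun x hx => hsub (hRs _ hx)⟩

/-- Bound on a Christoffel symbol contracted with the position vector. -/
theorem abs_sum_christoffel_mul_le {n : ℕ}
    {σ : EuclideanSpace ℝ (Fin n) → Matrix (Fin n) (Fin n) ℝ} {x : EuclideanSpace ℝ (Fin n)}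
    {ε : ℝ} (hM : ∀ i j, |(σ x)⁻¹ i j| ≤ 2)
    (hd : ∀ i j k, |pd k (fun y => σ y i j) x| * ‖x‖ ≤ ε) (i j : Fin n) :
    |∑ k, christoffel σ k i j x * x k| ≤ 3 * n ^ 2 * ε := by
  have hxk : ∀ k, |x k| ≤ ‖x‖ := fun k => by
    simpa using PiLp.norm_apply_le x k
  have key : ∀ k, |christoffel σ k i j x * x k| ≤ n * (3 * ε) := by
    intro k
    rw [christoffel, mul_assoc, Finset.sum_mul, Finset.mul_sum]
    refine abs_sum_le_mul fun l => ?_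
    have hε := hd l i j
    have hε' := hd l j i
    have hε'' := hd i j l
    set a := pd j (fun y => σ y l i) x
    set b := pd i (fun y => σ y l j) x
    set c := pd l (fun y => σ y i j) x
    have h1 : |a + b - c| * |x k| ≤ 3 * ε := by
      have h2 : |a + b - c| ≤ |a| + |b| + |c| := (abs_sub _ _).trans (by gcongr; exact abs_add_le a b)
      calc |a + b - c| * |x k| ≤ (|a| + |b| + |c|) * ‖x‖ := by gcongr; exact hxk k
        _ ≤ 3 * ε := by linarith
    rw [abs_mul, abs_mul, abs_mul, abs_of_pos (by norm_num : (0 : ℝ) < 1 / 2), mul_assoc]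
    have h3 := mul_le_mul (hM k l) h1 (by positivity) (by norm_num)
    linarith
  refine (abs_sum_le_mul key).trans (le_of_eq ?_)
  ring

theorem abs_gradSq_le {n : ℕ} {σ : EuclideanSpace ℝ (Fin n) → Matrix (Fin n) (Fin n) ℝ}
    {u : EuclideanSpace ℝ (Fin n) → ℝ} {x : EuclideanSpace ℝ (Fin n)} {η : ℝ}
    (hM : ∀ i j, |(σ x)⁻¹ i j| ≤ 2) (hu : ∀ i, |pd i u x| ≤ η) :
    |gradSq σ u x| ≤ 2 * n ^ 2 * η ^ 2 := by
  have : |gradSq σ u x| ≤ n * (n * (2 * η * η)) := by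
    refine abs_sum_le_mul fun i => abs_sum_le_mul fun j => ?_
    have hη : 0 ≤ η := (abs_nonneg _).trans (hu i)
    rw [abs_mul, abs_mul]
    gcongr <;> apply_assumption
  linarith

theorem abs_ginv_sub_le {n : ℕ} {σ : EuclideanSpace ℝ (Fin n) → Matrix (Fin n) (Fin n) ℝ}
    {u : EuclideanSpace ℝ (Fin n) → ℝ} {x : EuclideanSpace ℝ (Fin n)} {η : ℝ}
    (hM : ∀ i j, |(σ x)⁻¹ i j| ≤ 2) (hu : ∀ i, |pd i u x| ≤ η)
    (hη : 4 * n ^ 2 * η ^ 2 ≤ 1) (i j : Fin n) :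
    |ginv σ u i j x - (σ x)⁻¹ i j| ≤ 8 * n ^ 2 * η ^ 2 := by
  have hG : 1 / 2 ≤ 1 - gradSq σ u x := by
    have := (le_abs_self _).trans (abs_gradSq_le hM hu)
    linarith
  have hnum : |∑ k, ∑ l, (σ x)⁻¹ i k * (σ x)⁻¹ j l * pd k u x * pd l u x| ≤
      n * (n * (2 * 2 * η * η)) := by
    refine abs_sum_le_mul fun k => abs_sum_le_mul fun l => ?_
    have hη : 0 ≤ η := (abs_nonneg _).trans (hu i)
    rw [abs_mul, abs_mul, abs_mul]
    gcongr <;> apply_assumption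
  rw [ginv, add_sub_cancel_left, abs_div, abs_of_pos (by linarith : 0 < 1 - gradSq σ u x),
    div_le_iff₀ (by linarith)]
  have : (8 * n ^ 2 * η ^ 2) * (1 / 2) ≤ 8 * n ^ 2 * η ^ 2 * (1 - gradSq σ u x) := by gcongr
  linarith

/-- The contraction of two matrices close to `1` and to `P` is close to the trace of `P`. -/
theorem abs_sum_mul_sub_trace_le {n : ℕ} {G H P : Matrix (Fin n) (Fin n) ℝ} {κ : ℝ} (hκ : κ ≤ 1)
    (hG : ∀ i j, |G i j - (1 : Matrix (Fin n) (Fin n) ℝ) i j| ≤ κ)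
    (hH : ∀ i j, |H i j - P i j| ≤ κ) (hP : ∀ i j, |P i j| ≤ 2) :
    |∑ i, ∑ j, G i j * H i j - P.trace| ≤ n * (n * (4 * κ)) := by
  have htr : P.trace = ∑ i, ∑ j, (1 : Matrix (Fin n) (Fin n) ℝ) i j * P i j := by
    simp [Matrix.trace, Matrix.one_apply]
  rw [htr, ← Finset.sum_sub_distrib]
  refine abs_sum_le_mul fun i => ?_
  rw [← Finset.sum_sub_distrib]
  refine abs_sum_le_mul fun j => ?_
  have hκ0 : 0 ≤ κ := (abs_nonneg _).trans (hG i j)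
  set I : ℝ := (1 : Matrix (Fin n) (Fin n) ℝ) i j with hI
  have hI1 : |I| ≤ 1 := abs_one_apply_le i j
  have e : G i j * H i j - I * P i j =
      (G i j - I) * (H i j - P i j) + (G i j - I) * P i j + I * (H i j - P i j) := by ring
  rw [e]
  refine (abs_add_three _ _ _).trans ?_
  rw [abs_mul, abs_mul, abs_mul]
  have h1 := mul_le_mul (hG i j) ((hH i j).trans hκ) (abs_nonneg _) hκ0
  have h2 := mul_le_mul (hG i j) (hP i j) (abs_nonneg _) hκ0
  have h3 := mul_le_mul hI1 (hH i j) (abs_nonneg _) zero_le_one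
  linarith

/-- The function `A |x|^(-1/2)` is a static supersolution wherever the metric is close to the
flat one and the gradient is small. -/
theorem mcfOp_normSq_rpow_nonpos {n : ℕ} (hn : 3 ≤ n)
    {σ : EuclideanSpace ℝ (Fin n) → Matrix (Fin n) (Fin n) ℝ} {x : EuclideanSpace ℝ (Fin n)}
    {A ε : ℝ} (hA : 0 < A) (hx : x ≠ 0) (hε0 : 0 < ε) (hε : 144 * (n : ℝ) ^ 4 * ε ≤ 1)
    (hM : ∀ i j, |(σ x)⁻¹ i j - (1 : Matrix (Fin n) (Fin n) ℝ) i j| ≤ ε)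
    (hd : ∀ i j k, |pd k (fun y => σ y i j) x| * ‖x‖ ≤ ε)
    (hgrad : A * (‖x‖ ^ 2) ^ (-(1 / 4) : ℝ) / ‖x‖ ≤ ε) :
    mcfOp σ (fun y => A * (‖y‖ ^ 2) ^ (-(1 / 4) : ℝ)) x ≤ 0 := by
  have hxpos : 0 < ‖x‖ := norm_pos_iff.2 hx
  have hs : 0 < ‖x‖ ^ 2 := by positivity
  have hn3 : (3 : ℝ) ≤ n := by exact_mod_cast hn
  have hxk : ∀ k, |x k| ≤ ‖x‖ := fun k => by
    simpa using PiLp.norm_apply_le x k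
  have hn2 : (9 : ℝ) ≤ (n : ℝ) ^ 2 := by nlinarith
  have hn4 : (n : ℝ) ^ 4 = (n : ℝ) ^ 2 * (n : ℝ) ^ 2 := by ring
  have hκ : 9 * (n : ℝ) ^ 2 * ε ≤ 1 := by
    have : 9 * (n : ℝ) ^ 2 * ε ≤ 144 * ((n : ℝ) ^ 2 * (n : ℝ) ^ 2) * ε := by
      gcongr <;> nlinarith
    rw [hn4] at hε
    linarith
  have hε1 : ε ≤ 1 := by nlinarith
  have hM2 : ∀ i j, |(σ x)⁻¹ i j| ≤ 2 := fun i j => by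
    have h1 := abs_sub_abs_le_abs_sub ((σ x)⁻¹ i j) ((1 : Matrix (Fin n) (Fin n) ℝ) i j)
    have h2 := abs_one_apply_le i j
    linarith [hM i j]
  set q : ℝ := A * (‖x‖ ^ 2) ^ (-(1 / 4) - 1 : ℝ) with hq
  have hq0 : 0 < q := by positivity
  set u : EuclideanSpace ℝ (Fin n) → ℝ := fun y => A * (‖y‖ ^ 2) ^ (-(1 / 4) : ℝ) with hu
  have hpd : ∀ i, pd i u x = -(1 / 2) * q * x i := fun i => by
    rw [hu, pd_normSq_rpow A _ i hx, hq]; ring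
  have hpd2 : ∀ i j, pd i (fun z => pd j u z) x = q * (-(1 / 2) *
      (1 : Matrix (Fin n) (Fin n) ℝ) i j + 5 / 4 * (x i * x j / ‖x‖ ^ 2)) := fun i j => by
    rw [hu, pd_pd_normSq_rpow A _ i j hx, hq]; ring
  have hqx : q * ‖x‖ ≤ ε := by
    refine le_trans (le_of_eq ?_) hgrad
    rw [hq, Real.rpow_sub_one hs.ne']
    field_simp
  have hu1 : ∀ i, |pd i u x| ≤ ε := fun i => by
    rw [hpd, abs_mul, abs_mul, abs_of_pos hq0, abs_neg, abs_of_pos (by norm_num : (0 : ℝ) < 1 / 2)]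
    have := mul_le_mul_of_nonneg_left (hxk i) hq0.le
    nlinarith [abs_nonneg (x i)]
  have hεsq : ε ^ 2 ≤ ε := by nlinarith
  have hGη : 4 * (n : ℝ) ^ 2 * ε ^ 2 ≤ 1 := by nlinarith
  have hG : ∀ i j, |ginv σ u i j x - (1 : Matrix (Fin n) (Fin n) ℝ) i j| ≤ 9 * n ^ 2 * ε := by
    intro i j
    have h1 := abs_ginv_sub_le hM2 hu1 hGη i j
    have h2 := abs_sub_le (ginv σ u i j x) ((σ x)⁻¹ i j) ((1 : Matrix (Fin n) (Fin n) ℝ) i j)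
    have h3 := hM i j
    nlinarith
  let P : Matrix (Fin n) (Fin n) ℝ := fun i j =>
    -(1 / 2) * (1 : Matrix (Fin n) (Fin n) ℝ) i j + 5 / 4 * (x i * x j / ‖x‖ ^ 2)
  let H : Matrix (Fin n) (Fin n) ℝ := fun i j =>
    P i j + 1 / 2 * ∑ k, christoffel σ k i j x * x k
  have hcov : ∀ i j, covHess σ u i j x = q * H i j := fun i j => by
    simp only [covHess, hpd2, hpd, H, P, mul_add, Finset.mul_sum, sub_eq_add_neg,
      ← Finset.sum_neg_distrib]
    congr 1
    exact Finset.sum_congr rfl fun k _ => by ring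
  have hH : ∀ i j, |H i j - P i j| ≤ 9 * n ^ 2 * ε := fun i j => by
    have h1 := abs_sum_christoffel_mul_le hM2 hd i j
    have h2 : H i j - P i j = 1 / 2 * ∑ k, christoffel σ k i j x * x k := by simp [H]
    rw [h2, abs_mul, abs_of_pos (by norm_num : (0 : ℝ) < 1 / 2)]
    have : 0 ≤ (n : ℝ) ^ 2 * ε := by positivity
    linarith
  have hP : ∀ i j, |P i j| ≤ 2 := fun i j => by
    have h1 := abs_one_apply_le i j
    have h2 : |x i * x j / ‖x‖ ^ 2| ≤ 1 := by
      rw [abs_div, abs_of_pos hs, div_le_one hs, abs_mul, sq]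
      exact mul_le_mul (hxk i) (hxk j) (abs_nonneg _) (norm_nonneg _)
    rw [abs_le] at *
    constructor <;> simp only [P] <;> linarith
  have htr : P.trace = -(1 / 2) * n + 5 / 4 := by
    have hsum : ∑ i, x i * x i / ‖x‖ ^ 2 = 1 := by
      rw [← Finset.sum_div, div_eq_one_iff_eq hs.ne', EuclideanSpace.real_norm_sq_eq]
      exact Finset.sum_congr rfl fun i _ => by ring
    simp only [Matrix.trace, Matrix.diag, P, Finset.sum_add_distrib, ← Finset.mul_sum, hsum]
    simp
  have hmain := abs_sum_mul_sub_trace_le (G := fun i j => ginv σ u i j x) hκ hG hH hP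
  have hop : mcfOp σ u x = q * ∑ i, ∑ j, ginv σ u i j x * H i j := by
    simp only [mcfOp, hcov, Finset.mul_sum]
    exact Finset.sum_congr rfl fun i _ => Finset.sum_congr rfl fun j _ => by ring
  rw [hop]
  refine mul_nonpos_of_nonneg_of_nonpos hq0.le ?_
  have h1 := (abs_le.1 hmain).2
  rw [htr] at h1
  have h2 : (n : ℝ) * (n * (4 * (9 * n ^ 2 * ε))) ≤ 1 / 4 := by
    have : (n : ℝ) * (n * (4 * (9 * n ^ 2 * ε))) = 1 / 4 * (144 * (n : ℝ) ^ 4 * ε) := by ring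
    linarith
  linarith

/- STATEMENT 5: For an asymptotically flat metric σ on ℝⁿ, n ≥ 3, and any h > 0, r₁ > 0,
there exist r₀ ≥ r₁ and a rotationally symmetric smooth function b on ℝⁿ∖B_{r₀}(0) with
b > 0, b → 0 at infinity, b ≥ h on ∂B_{r₀}(0), and g^{ij}(σ,∇b)(∇²_σ b)_{ij} ≤ 0,
i.e. b is a static supersolution of the graphical mean curvature flow. -/
theorem stmt_5 (n : ℕ) (hn : 3 ≤ n)
    (σ : EuclideanSpace ℝ (Fin n) → Matrix (Fin n) (Fin n) ℝ) (R₀ C : ℝ) (ω : ℝ → ℝ)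
    (hσ : IsAsympFlat σ R₀ C ω) (h : ℝ) (hh : 0 < h) (r₁ : ℝ) (hr₁ : 0 < r₁) :
    ∃ r₀ : ℝ, r₁ ≤ r₀ ∧ 0 < r₀ ∧
      ∃ b : EuclideanSpace ℝ (Fin n) → ℝ,
        ContDiffOn ℝ (⊤ : ℕ∞) b {x : EuclideanSpace ℝ (Fin n) | r₀ ≤ ‖x‖} ∧
        (∃ β : ℝ → ℝ, ∀ x : EuclideanSpace ℝ (Fin n), r₀ ≤ ‖x‖ → b x = β ‖x‖) ∧
        (∀ x : EuclideanSpace ℝ (Fin n), r₀ ≤ ‖x‖ → 0 < b x) ∧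
        (∀ ε : ℝ, 0 < ε → ∃ Rb : ℝ, ∀ x : EuclideanSpace ℝ (Fin n), Rb ≤ ‖x‖ → |b x| < ε) ∧
        (∀ x : EuclideanSpace ℝ (Fin n), ‖x‖ = r₀ → h ≤ b x) ∧
        (∀ x : EuclideanSpace ℝ (Fin n), r₀ ≤ ‖x‖ → mcfOp σ b x ≤ 0) := by
  have hnpos : (0 : ℝ) < n := by exact_mod_cast (by omega : 0 < n)
  set ε : ℝ := 1 / (144 * (n : ℝ) ^ 4) with hεdef
  have hε : 0 < ε := by positivity
  have hε1 : 144 * (n : ℝ) ^ 4 * ε ≤ 1 := by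
    rw [hεdef, mul_one_div_cancel (by positivity)]
  obtain ⟨R, hR⟩ := hσ.exists_close hε
  set r₀ : ℝ := max r₁ (max R (h / ε)) with hr₀
  have h1 : r₁ ≤ r₀ := le_max_left _ _
  have h2 : R ≤ r₀ := (le_max_left _ _).trans (le_max_right _ _)
  have h3 : h / ε ≤ r₀ := (le_max_right _ _).trans (le_max_right _ _)
  have hr₀pos : 0 < r₀ := hr₁.trans_le h1
  set A : ℝ := h * (r₀ ^ 2) ^ (1 / 4 : ℝ) with hAdef
  have hA : 0 < A := by positivity
  have hAr : A * (r₀ ^ 2) ^ (-(1 / 4) : ℝ) = h := by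
    rw [hAdef, mul_assoc, ← Real.rpow_add (by positivity)]
    simp
  have hne : ∀ x : EuclideanSpace ℝ (Fin n), r₀ ≤ ‖x‖ → x ≠ 0 := fun x hx =>
    norm_pos_iff.1 (hr₀pos.trans_le hx)
  refine ⟨r₀, h1, hr₀pos, fun x => A * (‖x‖ ^ 2) ^ (-(1 / 4) : ℝ), ?_,
    ⟨fun r => A * (r ^ 2) ^ (-(1 / 4) : ℝ), fun x _ => rfl⟩, ?_, ?_, ?_, ?_⟩
  · refine contDiffOn_const.mul ?_
    refine (contDiff_norm_sq ℝ).contDiffOn.rpow_const_of_ne fun x hx => ?_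
    exact pow_ne_zero _ (norm_ne_zero_iff.2 (hne x hx))
  · intro x hx
    have := norm_pos_iff.2 (hne x hx)
    positivity
  · intro ε' hε'
    have ht : Tendsto (fun r : ℝ => A * (r ^ 2) ^ (-(1 / 4) : ℝ)) atTop (nhds 0) := by
      have := ((tendsto_rpow_neg_atTop (by norm_num : (0 : ℝ) < 1 / 4)).comp
        (tendsto_pow_atTop (α := ℝ) two_ne_zero)).const_mul A
      simpa using this
    obtain ⟨Rb, hRb⟩ := eventually_atTop.1 (ht.eventually (Metric.ball_mem_nhds 0 hε'))
    exact ⟨Rb, fun x hx => by simpa using hRb ‖x‖ hx⟩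
  · intro x hx
    simp only [hx]
    exact hAr.ge
  · intro x hx
    obtain ⟨hM, hd⟩ := hR x (h2.trans hx)
    refine mcfOp_normSq_rpow_nonpos hn hA (hne x hx) hε hε1 hM hd ?_
    have hxpos : 0 < ‖x‖ := norm_pos_iff.2 (hne x hx)
    have hle : A * (‖x‖ ^ 2) ^ (-(1 / 4) : ℝ) ≤ h := by
      rw [← hAr]
      gcongr ?_ * ?_
      exact Real.rpow_le_rpow_of_nonpos (by positivity) (by gcongr) (by norm_num)
    rw [div_le_iff₀ hxpos]
    rw [div_le_iff₀ hε] at h3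
    calc _ ≤ h := hle
      _ ≤ r₀ * ε := h3
      _ ≤ ε * ‖x‖ := by rw [mul_comm]; gcongr
end
end

section
/- Let T ∈ (0,∞], let n ≥ 3, and let σ be a smooth asymptotically flat Riemannian metric on ℝⁿ. Suppose u₀ : ℝⁿ → ℝ is bounded and Lipschitz with u₀(x) → 0 as |x| → ∞, and suppose u ∈ C^{2;1}(ℝⁿ×(0,T)) ∩ C⁰(ℝⁿ×[0,T)) solves ∂_t u = g^{ij}(σ,∇u)(∇²_σ u)_{ij} with u(·,0) = u₀ and is uniformly spacelike, i.e. |∇u|²_σ ≤ 1 − μ on ℝⁿ×(0,T) for some μ > 0. Then for every t ∈ (0,T), u(x,t) → 0 as |x| → ∞. Moreover, this convergence is uniform in t and in u in the following sense: there is a function b : ℝⁿ → (0,∞), depending only on u₀ and σ, such that |u(x,t)| ≤ b(x) for all (x,t) ∈ ℝⁿ×(0,T) and b(x) → 0 as |x| → ∞. -/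
noncomputable section
open Real Set Filter MeasureTheory Metric ENNReal

open scoped Topology

theorem iterated_deriv_nonpos_of_isLocalMax {g : ℝ → ℝ} {x : ℝ} (hg : IsLocalMax g x)
    (hc : ContinuousAt g x) : deriv (deriv g) x ≤ 0 := by
  by_contra! h
  have hmin := isLocalMin_of_deriv_deriv_pos h hg.deriv_eq_zero hc
  have hconst : g =ᶠ[𝓝 x] fun _ => g x := by
    filter_upwards [hmin, hg] with y h1 h2 using le_antisymm h2 h1
  have h1 : deriv g =ᶠ[𝓝 x] fun _ => 0 := by
    simpa using hconst.deriv
  have h2 := h1.deriv_eq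
  simp at h2
  linarith

theorem fderiv_apply_eq_sum_pd {n : ℕ} (f : EuclideanSpace ℝ (Fin n) → ℝ)
    (x v : EuclideanSpace ℝ (Fin n)) : fderiv ℝ f x v = ∑ i, v i * pd i f x := by
  have hv : v = ∑ i, v i • EuclideanSpace.single i (1 : ℝ) := by
    simpa using ((EuclideanSpace.basisFun (Fin n) ℝ).sum_repr v).symm
  conv_lhs => rw [hv]
  simp [pd]

theorem differentiableAt_pd {n : ℕ} {f : EuclideanSpace ℝ (Fin n) → ℝ}
    {x : EuclideanSpace ℝ (Fin n)} (hf : ContDiffAt ℝ 2 f x) (i : Fin n) :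
    DifferentiableAt ℝ (fun y => pd i f y) x := by
  have h : ContDiffAt ℝ 1 (fderiv ℝ f) x := hf.fderiv_right (by norm_num)
  exact (h.differentiableAt (by norm_num)).clm_apply (differentiableAt_const _)

theorem pd_eq_zero_of_isLocalMax {n : ℕ} {f : EuclideanSpace ℝ (Fin n) → ℝ}
    {x : EuclideanSpace ℝ (Fin n)} (h : IsLocalMax f x) (i : Fin n) : pd i f x = 0 := by
  simp [pd, h.fderiv_eq_zero]

theorem hessian_nonpos_of_isLocalMax {n : ℕ} {f : EuclideanSpace ℝ (Fin n) → ℝ}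
    {x : EuclideanSpace ℝ (Fin n)} (hf : ContDiffAt ℝ 2 f x) (h : IsLocalMax f x)
    (v : Fin n → ℝ) : ∑ i, ∑ j, v i * v j * pd i (fun y => pd j f y) x ≤ 0 := by
  set V : EuclideanSpace ℝ (Fin n) := WithLp.toLp 2 v
  have hline (s : ℝ) : HasDerivAt (fun s : ℝ => x + s • V) V s := by
    simpa using ((hasDerivAt_id s).smul_const V).const_add x
  have hcont : ContinuousAt (fun s : ℝ => x + s • V) 0 := (hline 0).continuousAt
  have ht : Tendsto (fun s : ℝ => x + s • V) (𝓝 0) (𝓝 x) := by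
    simpa [ContinuousAt] using hcont
  have hdiff : ∀ᶠ y in 𝓝 x, DifferentiableAt ℝ f y := by
    filter_upwards [hf.eventually (by norm_num)] with y hy
    exact hy.differentiableAt (by norm_num)
  have hx0 : x + (0 : ℝ) • V = x := by simp
  have hmax : IsLocalMax (fun s : ℝ => f (x + s • V)) 0 := by
    filter_upwards [ht.eventually h] with s hs
    simpa using hs
  have hd1 : deriv (fun s : ℝ => f (x + s • V)) =ᶠ[𝓝 0]
      fun s => ∑ j, v j * pd j f (x + s • V) := by
    filter_upwards [ht.eventually hdiff] with s hs
    refine (hs.hasFDerivAt.comp_hasDerivAt s (hline s)).deriv.trans ?_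
    rw [fderiv_apply_eq_sum_pd]
  have hd2 : HasDerivAt (fun s : ℝ => ∑ j, v j * pd j f (x + s • V))
      (∑ j, v j * ∑ i, v i * pd i (fun y => pd j f y) x) 0 := by
    refine HasDerivAt.fun_sum fun j _ => HasDerivAt.const_mul _ ?_
    have h1 : HasFDerivAt (fun y => pd j f y) (fderiv ℝ (fun y => pd j f y) x)
        (x + (0 : ℝ) • V) := by
      rw [hx0]; exact (differentiableAt_pd hf j).hasFDerivAt
    have h2 := h1.comp_hasDerivAt (0 : ℝ) (hline 0)
    rw [fderiv_apply_eq_sum_pd] at h2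
    exact h2
  have hfc : ContinuousAt (fun s : ℝ => f (x + s • V)) 0 := by
    refine ContinuousAt.comp (g := f) ?_ hcont
    rw [hx0]; exact hf.continuousAt
  have key := iterated_deriv_nonpos_of_isLocalMax hmax hfc
  rw [hd1.deriv_eq, hd2.deriv] at key
  refine le_of_eq_of_le ?_ key
  rw [Finset.sum_comm]
  simp only [Finset.mul_sum]
  exact Finset.sum_congr rfl fun j _ => Finset.sum_congr rfl fun i _ => by ring

theorem pd_sub {n : ℕ} {f g : EuclideanSpace ℝ (Fin n) → ℝ} {x : EuclideanSpace ℝ (Fin n)}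
    (hf : DifferentiableAt ℝ f x) (hg : DifferentiableAt ℝ g x) (i : Fin n) :
    pd i (fun y => f y - g y) x = pd i f x - pd i g x := by
  simp [pd, fderiv_fun_sub hf hg]

theorem pd_pd_sub {n : ℕ} {f g : EuclideanSpace ℝ (Fin n) → ℝ} {x : EuclideanSpace ℝ (Fin n)}
    (hf : ContDiffAt ℝ 2 f x) (hg : ContDiffAt ℝ 2 g x) (i j : Fin n) :
    pd i (fun y => pd j (fun z => f z - g z) y) x =
      pd i (fun y => pd j f y) x - pd i (fun y => pd j g y) x := by
  have h : (fun y => pd j (fun z => f z - g z) y) =ᶠ[𝓝 x] fun y => pd j f y - pd j g y := by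
    filter_upwards [hf.eventually (by norm_num), hg.eventually (by norm_num)] with y h1 h2
    exact pd_sub (h1.differentiableAt (by norm_num)) (h2.differentiableAt (by norm_num)) j
  rw [← pd_sub (differentiableAt_pd hf j) (differentiableAt_pd hg j), pd, pd, h.fderiv_eq]

theorem sum_posSemidef_mul_nonpos {n : ℕ} {S H : Matrix (Fin n) (Fin n) ℝ} (hS : S.PosSemidef)
    (hH : ∀ v : Fin n → ℝ, ∑ i, ∑ j, v i * v j * H i j ≤ 0) : ∑ i, ∑ j, S i j * H i j ≤ 0 := by
  obtain ⟨m, v, rfl⟩ := Matrix.posSemidef_iff_eq_sum_vecMulVec.1 hS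
  have : ∑ i, ∑ j, (∑ k, Matrix.vecMulVec (v k) (star (v k))) i j * H i j =
      ∑ k, ∑ i, ∑ j, v k i * v k j * H i j := by
    simp only [Matrix.sum_apply, Matrix.vecMulVec_apply, Finset.sum_mul, star_trivial]
    rw [Finset.sum_comm]
    simp_rw [Finset.sum_comm (s := (Finset.univ : Finset (Fin m)))]
    rw [Finset.sum_comm]
  rw [this]
  exact Finset.sum_nonpos fun k _ => hH (v k)

theorem sum_ginv_mul_nonpos {n : ℕ} {σ : EuclideanSpace ℝ (Fin n) → Matrix (Fin n) (Fin n) ℝ}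
    {u : EuclideanSpace ℝ (Fin n) → ℝ} {x : EuclideanSpace ℝ (Fin n)} (hσ : (σ x).PosDef)
    (hu : gradSq σ u x < 1) {H : Fin n → Fin n → ℝ}
    (hH : ∀ v : Fin n → ℝ, ∑ i, ∑ j, v i * v j * H i j ≤ 0) :
    ∑ i, ∑ j, ginv σ u i j x * H i j ≤ 0 := by
  set p : Fin n → ℝ := fun i => ∑ k, (σ x)⁻¹ i k * pd k u x
  have hg (i j : Fin n) : ginv σ u i j x = (σ x)⁻¹ i j + p i * p j * (1 - gradSq σ u x)⁻¹ := by
    simp only [ginv, p, Finset.sum_mul_sum, div_eq_mul_inv]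
    congr 2
    exact Finset.sum_congr rfl fun k _ => Finset.sum_congr rfl fun l _ => by ring
  have h1 := sum_posSemidef_mul_nonpos (H := H) hσ.inv.posSemidef hH
  have h2 := mul_nonpos_of_nonneg_of_nonpos (inv_nonneg.2 (sub_nonneg.2 hu.le)) (hH p)
  have h3 : ∑ i, ∑ j, ginv σ u i j x * H i j = ∑ i, ∑ j, (σ x)⁻¹ i j * H i j +
      (1 - gradSq σ u x)⁻¹ * ∑ i, ∑ j, p i * p j * H i j := by
    simp only [Finset.mul_sum, ← Finset.sum_add_distrib, hg]
    exact Finset.sum_congr rfl fun k _ => Finset.sum_congr rfl fun l _ => by ring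
  rw [h3]
  linarith

theorem mcfOp_le_of_isLocalMax_sub {n : ℕ}
    {σ : EuclideanSpace ℝ (Fin n) → Matrix (Fin n) (Fin n) ℝ}
    {u w : EuclideanSpace ℝ (Fin n) → ℝ} {x : EuclideanSpace ℝ (Fin n)} (hσ : (σ x).PosDef)
    (hu : ContDiffAt ℝ 2 u x) (hw : ContDiffAt ℝ 2 w x) (hgrad : gradSq σ u x < 1)
    (hmax : IsLocalMax (fun y => u y - w y) x) :
    (∀ i, pd i u x = pd i w x) ∧
      mcfOp σ u x ≤ ∑ i, ∑ j, ginv σ u i j x * covHess σ w i j x := by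
  have h1 (i : Fin n) : pd i u x = pd i w x := by
    have := pd_eq_zero_of_isLocalMax hmax i
    rw [pd_sub (hu.differentiableAt (by norm_num)) (hw.differentiableAt (by norm_num))] at this
    linarith
  refine ⟨h1, ?_⟩
  have h2 := sum_ginv_mul_nonpos hσ hgrad (hessian_nonpos_of_isLocalMax (hu.sub hw) hmax)
  simp only [pd_pd_sub hu hw] at h2
  rw [← sub_nonpos, mcfOp]
  simp only [← Finset.sum_sub_distrib]
  refine le_of_eq_of_le ?_ h2
  refine Finset.sum_congr rfl fun i _ => Finset.sum_congr rfl fun j _ => ?_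
  simp only [covHess, h1]
  ring

/-- Contraction `Γ^k_{ij} x_k` of the Christoffel symbols with the position vector. -/
def radialChristoffel {n : ℕ} (σ : EuclideanSpace ℝ (Fin n) → Matrix (Fin n) (Fin n) ℝ)
    (i j : Fin n) (x : EuclideanSpace ℝ (Fin n)) : ℝ :=
  ∑ k, christoffel σ k i j x * x k

theorem pd_comp_norm_sq {n : ℕ} {F : ℝ → ℝ} {F' : ℝ} {x : EuclideanSpace ℝ (Fin n)}
    (hF : HasDerivAt F F' (‖x‖ ^ 2)) (i : Fin n) :
    pd i (fun y => F (‖y‖ ^ 2)) x = 2 * F' * x i := by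
  have h := hF.comp_hasFDerivAt x (hasStrictFDerivAt_norm_sq x).hasFDerivAt
  rw [pd, HasFDerivAt.fderiv (f := fun y => F (‖y‖ ^ 2)) h]
  simp [EuclideanSpace.inner_single_right]
  ring

theorem pd_coord {n : ℕ} (x : EuclideanSpace ℝ (Fin n)) (i j : Fin n) :
    pd i (fun y => y j) x = (1 : Matrix (Fin n) (Fin n) ℝ) i j := by
  have h := (EuclideanSpace.proj j : EuclideanSpace ℝ (Fin n) →L[ℝ] ℝ).hasFDerivAt (x := x)
  rw [pd, HasFDerivAt.fderiv (f := fun y : EuclideanSpace ℝ (Fin n) => y j) h]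
  simp [Matrix.one_apply, eq_comm]

theorem pd_mul {n : ℕ} {f g : EuclideanSpace ℝ (Fin n) → ℝ} {x : EuclideanSpace ℝ (Fin n)}
    (hf : DifferentiableAt ℝ f x) (hg : DifferentiableAt ℝ g x) (i : Fin n) :
    pd i (fun y => f y * g y) x = f x * pd i g x + pd i f x * g x := by
  simp [pd, fderiv_fun_mul hf hg, mul_comm]

theorem pd_pd_comp_norm_sq {n : ℕ} {F F' : ℝ → ℝ} {F'' : ℝ} {x : EuclideanSpace ℝ (Fin n)}
    (hF : ∀ᶠ s in 𝓝 (‖x‖ ^ 2), HasDerivAt F (F' s) s) (hF' : HasDerivAt F' F'' (‖x‖ ^ 2))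
    (i j : Fin n) :
    pd i (fun y => pd j (fun z => F (‖z‖ ^ 2)) y) x =
      2 * F' (‖x‖ ^ 2) * (1 : Matrix (Fin n) (Fin n) ℝ) i j + 4 * F'' * (x i * x j) := by
  have hcont : Tendsto (fun y : EuclideanSpace ℝ (Fin n) => ‖y‖ ^ 2) (𝓝 x) (𝓝 (‖x‖ ^ 2)) :=
    (continuous_norm.pow 2).continuousAt
  have h : (fun y => pd j (fun z => F (‖z‖ ^ 2)) y) =ᶠ[𝓝 x] fun y => (2 * F' (‖y‖ ^ 2)) * y j := by
    filter_upwards [hcont.eventually hF] with y hy using pd_comp_norm_sq hy j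
  have h2 := hF'.const_mul 2
  have h3 : DifferentiableAt ℝ (fun y : EuclideanSpace ℝ (Fin n) => 2 * F' (‖y‖ ^ 2)) x :=
    DifferentiableAt.comp (g := fun s => 2 * F' s) x h2.differentiableAt
      (hasStrictFDerivAt_norm_sq x).differentiableAt
  have h4 : DifferentiableAt ℝ (fun y : EuclideanSpace ℝ (Fin n) => y j) x := by fun_prop
  have h5 := pd_mul h3 h4 i
  rw [pd_coord, pd_comp_norm_sq h2] at h5
  rw [pd, h.fderiv_eq, ← pd, h5]
  ring

theorem sum_mul_covHess_comp_norm_sq {n : ℕ}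
    (σ : EuclideanSpace ℝ (Fin n) → Matrix (Fin n) (Fin n) ℝ)
    {F F' : ℝ → ℝ} {F'' : ℝ} {x : EuclideanSpace ℝ (Fin n)}
    (hF : ∀ᶠ s in 𝓝 (‖x‖ ^ 2), HasDerivAt F (F' s) s) (hF' : HasDerivAt F' F'' (‖x‖ ^ 2))
    (G : Fin n → Fin n → ℝ) :
    ∑ i, ∑ j, G i j * covHess σ (fun y => F (‖y‖ ^ 2)) i j x =
      2 * F' (‖x‖ ^ 2) * (∑ i, G i i - ∑ i, ∑ j, G i j * radialChristoffel σ i j x) +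
        4 * F'' * ∑ i, ∑ j, G i j * (x i * x j) := by
  have h1 (i j : Fin n) : covHess σ (fun y => F (‖y‖ ^ 2)) i j x =
      2 * F' (‖x‖ ^ 2) * (1 : Matrix (Fin n) (Fin n) ℝ) i j + 4 * F'' * (x i * x j) -
        2 * F' (‖x‖ ^ 2) * radialChristoffel σ i j x := by
    rw [covHess, pd_pd_comp_norm_sq hF hF', radialChristoffel, Finset.mul_sum]
    congr 1
    refine Finset.sum_congr rfl fun k _ => ?_
    rw [pd_comp_norm_sq hF.self_of_nhds]
    ring
  have h2 (i : Fin n) : G i i = ∑ j, G i j * (1 : Matrix (Fin n) (Fin n) ℝ) i j := by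
    simp [Matrix.one_apply]
  rw [Finset.sum_congr rfl fun i _ => h2 i]
  simp only [h1, ← Finset.sum_sub_distrib, Finset.mul_sum, ← Finset.sum_add_distrib]
  exact Finset.sum_congr rfl fun i _ => Finset.sum_congr rfl fun j _ => by ring

/-- The coefficients `g^{ij}` as functions of the metric matrix `S` and the covector `p`. -/
def graphCoeff {n : ℕ} (S : Matrix (Fin n) (Fin n) ℝ) (p : Fin n → ℝ) (i j : Fin n) : ℝ :=
  S⁻¹ i j + (∑ k, ∑ l, S⁻¹ i k * S⁻¹ j l * p k * p l) / (1 - ∑ k, ∑ l, S⁻¹ k l * p k * p l)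

theorem ginv_eq_graphCoeff {n : ℕ} (σ : EuclideanSpace ℝ (Fin n) → Matrix (Fin n) (Fin n) ℝ)
    (u : EuclideanSpace ℝ (Fin n) → ℝ) (i j : Fin n) (x : EuclideanSpace ℝ (Fin n)) :
    ginv σ u i j x = graphCoeff (σ x) (fun k => pd k u x) i j := rfl

theorem exists_bound_of_tendsto_cobounded {n : ℕ} {f : EuclideanSpace ℝ (Fin n) → ℝ}
    (hf : Continuous f) {l : ℝ} (h : Tendsto f (Bornology.cobounded _) (𝓝 l)) :
    ∃ B, 0 ≤ B ∧ ∀ x, |f x| ≤ B := by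
  have h1 : ∀ᶠ x in Bornology.cobounded (EuclideanSpace ℝ (Fin n)), |f x| < |l| + 1 :=
    h.abs.eventually (gt_mem_nhds (by linarith))
  obtain ⟨r, -, hr⟩ := (hasBasis_cobounded_norm (E := EuclideanSpace ℝ (Fin n))).eventually_iff.1 h1
  obtain ⟨B, hB⟩ := (isCompact_closedBall (0 : EuclideanSpace ℝ (Fin n)) r).exists_bound_of_continuousOn
    hf.continuousOn
  refine ⟨max B (|l| + 1), le_max_of_le_right (by positivity), fun x => ?_⟩
  rcases le_total r ‖x‖ with hx | hx
  · exact le_max_of_le_right (hr hx).le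
  · exact le_max_of_le_left (hB x (by simpa using hx))

section AsympFlat

variable {n : ℕ} {σ : EuclideanSpace ℝ (Fin n) → Matrix (Fin n) (Fin n) ℝ} {R₀ C : ℝ} {ω : ℝ → ℝ}

theorem IsAsympFlat.posDef (h : IsAsympFlat σ R₀ C ω) (x : EuclideanSpace ℝ (Fin n)) :
    (σ x).PosDef := h.2.2.2.1 x

theorem IsAsympFlat.continuous (h : IsAsympFlat σ R₀ C ω) : Continuous σ :=
  continuous_matrix fun i j => (h.2.2.1 i j).continuous

theorem IsAsympFlat.continuous_inv (h : IsAsympFlat σ R₀ C ω) : Continuous fun x => (σ x)⁻¹ := by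
  rw [continuous_iff_continuousAt]
  intro x
  refine ContinuousAt.comp (g := Inv.inv) (continuousAt_matrix_inv _ ?_) h.continuous.continuousAt
  rw [Ring.inverse_eq_inv']
  exact continuousAt_inv₀ (h.posDef x).det_pos.ne'

theorem IsAsympFlat.tendsto_modulus (h : IsAsympFlat σ R₀ C ω) :
    Tendsto (fun x : EuclideanSpace ℝ (Fin n) => C * ω ‖x‖) (Bornology.cobounded _) (𝓝 0) := by
  simpa using (h.2.2.2.2.2.1.comp tendsto_norm_cobounded_atTop).const_mul C

theorem IsAsympFlat.eventually_le_norm (_h : IsAsympFlat σ R₀ C ω) (r : ℝ) :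
    ∀ᶠ x in Bornology.cobounded (EuclideanSpace ℝ (Fin n)), r ≤ ‖x‖ :=
  tendsto_norm_cobounded_atTop.eventually_ge_atTop r

theorem IsAsympFlat.tendsto (h : IsAsympFlat σ R₀ C ω) :
    Tendsto σ (Bornology.cobounded _) (𝓝 1) := by
  refine tendsto_pi_nhds.2 fun i => tendsto_pi_nhds.2 fun j => ?_
  rw [tendsto_iff_norm_sub_tendsto_zero]
  refine squeeze_zero' (Eventually.of_forall fun x => norm_nonneg _) ?_ h.tendsto_modulus
  filter_upwards [h.eventually_le_norm R₀] with x hx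
  exact (h.2.2.2.2.2.2 x hx).1 i j

theorem IsAsympFlat.tendsto_inv (h : IsAsympFlat σ R₀ C ω) :
    Tendsto (fun x => (σ x)⁻¹) (Bornology.cobounded _) (𝓝 1) := by
  have h1 : ContinuousAt Inv.inv (1 : Matrix (Fin n) (Fin n) ℝ) := by
    refine continuousAt_matrix_inv _ ?_
    rw [Ring.inverse_eq_inv']
    exact continuousAt_inv₀ (by simp)
  have h2 := h1.tendsto.comp h.tendsto
  rwa [inv_one] at h2

theorem IsAsympFlat.tendsto_pd_mul (h : IsAsympFlat σ R₀ C ω) (i j k m : Fin n) :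
    Tendsto (fun x => pd k (fun y => σ y i j) x * x m) (Bornology.cobounded _) (𝓝 0) := by
  rw [tendsto_zero_iff_norm_tendsto_zero]
  refine squeeze_zero' (Eventually.of_forall fun x => norm_nonneg _) ?_ h.tendsto_modulus
  filter_upwards [h.eventually_le_norm R₀] with x hx
  have hx0 : 0 < ‖x‖ := h.1.trans_le hx
  have h1 := (h.2.2.2.2.2.2 x hx).2 i j k
  rw [norm_mul]
  calc _ ≤ C * ω ‖x‖ / ‖x‖ * ‖x‖ :=
        mul_le_mul h1 (PiLp.norm_apply_le x m) (norm_nonneg _) ((abs_nonneg _).trans h1)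
    _ = _ := by field_simp

theorem IsAsympFlat.continuous_pd (h : IsAsympFlat σ R₀ C ω) (i j k : Fin n) :
    Continuous fun x => pd k (fun y => σ y i j) x :=
  ((h.2.2.1 i j).continuous_fderiv (by simp)).clm_apply continuous_const

theorem IsAsympFlat.continuous_radialChristoffel (h : IsAsympFlat σ R₀ C ω) (i j : Fin n) :
    Continuous (radialChristoffel σ i j) := by
  refine continuous_finsetSum _ fun k _ => Continuous.mul ?_ (by fun_prop)
  refine continuous_const.mul (continuous_finsetSum _ fun l _ => Continuous.mul ?_ ?_)
  · exact h.continuous_inv.matrix_elem k l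
  · exact ((h.continuous_pd _ _ _).add (h.continuous_pd _ _ _)).sub (h.continuous_pd _ _ _)

theorem IsAsympFlat.tendsto_inv_apply (h : IsAsympFlat σ R₀ C ω) (i j : Fin n) :
    Tendsto (fun x => (σ x)⁻¹ i j) (Bornology.cobounded _)
      (𝓝 ((1 : Matrix (Fin n) (Fin n) ℝ) i j)) :=
  tendsto_pi_nhds.1 (tendsto_pi_nhds.1 h.tendsto_inv i) j

theorem IsAsympFlat.tendsto_radialChristoffel (h : IsAsympFlat σ R₀ C ω) (i j : Fin n) :
    Tendsto (radialChristoffel σ i j) (Bornology.cobounded _) (𝓝 0) := by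
  have h1 (k l : Fin n) := (h.tendsto_inv_apply k l).mul
    (((h.tendsto_pd_mul l i j k).add (h.tendsto_pd_mul l j i k)).sub (h.tendsto_pd_mul i j l k))
  have h2 := tendsto_finsetSum Finset.univ fun k _ =>
    (tendsto_finsetSum Finset.univ fun l _ => h1 k l).const_mul (1 / 2)
  simp only [add_zero, sub_zero, mul_zero, Finset.sum_const_zero] at h2
  refine h2.congr fun x => ?_
  simp only [radialChristoffel, christoffel, Finset.mul_sum, Finset.sum_mul]
  exact Finset.sum_congr rfl fun k _ => Finset.sum_congr rfl fun l _ => by ring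

theorem IsAsympFlat.tendsto_graphCoeff (h : IsAsympFlat σ R₀ C ω) (i j : Fin n) :
    Tendsto (fun q : EuclideanSpace ℝ (Fin n) × (Fin n → ℝ) => graphCoeff (σ q.1) q.2 i j)
      (Bornology.cobounded _ ×ˢ 𝓝 0) (𝓝 ((1 : Matrix (Fin n) (Fin n) ℝ) i j)) := by
  have hS (i j : Fin n) := (h.tendsto_inv_apply i j).comp
    (tendsto_fst (f := Bornology.cobounded (EuclideanSpace ℝ (Fin n)))
      (g := 𝓝 (0 : Fin n → ℝ)))
  have hp (i : Fin n) := (tendsto_pi_nhds.1 (tendsto_id (x := 𝓝 (0 : Fin n → ℝ))) i).comp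
    (tendsto_snd (f := Bornology.cobounded (EuclideanSpace ℝ (Fin n)))
      (g := 𝓝 (0 : Fin n → ℝ)))
  have hnum := tendsto_finsetSum Finset.univ fun k _ => tendsto_finsetSum Finset.univ fun l _ =>
    (((hS i k).mul (hS j l)).mul (hp k)).mul (hp l)
  have hden := tendsto_finsetSum Finset.univ fun k _ => tendsto_finsetSum Finset.univ fun l _ =>
    ((hS k l).mul (hp k)).mul (hp l)
  have h1 := (hS i j).add (hnum.div (hden.const_sub 1) (by simp))
  simpa [graphCoeff] using h1

end AsympFlat

/-- The trace of `g^{ij}` minus its contraction with `Γ^k_{ij} x_k`. -/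
def radialTrace {n : ℕ} (σ : EuclideanSpace ℝ (Fin n) → Matrix (Fin n) (Fin n) ℝ)
    (p : Fin n → ℝ) (x : EuclideanSpace ℝ (Fin n)) : ℝ :=
  ∑ i, graphCoeff (σ x) p i i - ∑ i, ∑ j, graphCoeff (σ x) p i j * radialChristoffel σ i j x

theorem exists_uniform_bound {ι X : Type*} [Fintype ι] {f : ι → X → ℝ}
    (h : ∀ i, ∃ B, 0 ≤ B ∧ ∀ x, |f i x| ≤ B) : ∃ B, 0 ≤ B ∧ ∀ i x, |f i x| ≤ B := by
  choose B hB0 hB using h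
  exact ⟨∑ i, B i, Finset.sum_nonneg fun i _ => hB0 i, fun i x =>
    (hB i x).trans (Finset.single_le_sum (fun i _ => hB0 i) (Finset.mem_univ i))⟩

theorem sq_le_diag_mul_inv_form {n : ℕ} {S : Matrix (Fin n) (Fin n) ℝ} (hS : S.PosDef)
    (p : Fin n → ℝ) (i : Fin n) : p i ^ 2 ≤ S i i * ∑ k, ∑ l, S⁻¹ k l * p k * p l := by
  have hii : 0 < S i i := hS.diag_pos
  have hunit : IsUnit S.det := hS.det_pos.ne'.isUnit
  set v := S⁻¹.mulVec p with hv
  have hSv : S.mulVec v = p := by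
    rw [hv, Matrix.mulVec_mulVec, Matrix.mul_nonsing_inv _ hunit, Matrix.one_mulVec]
  have hT : S.transpose = S := by simpa using hS.isHermitian.eq
  set e : Fin n → ℝ := Pi.single i 1 with he
  have h1 : v ⬝ᵥ S.mulVec e = p i := by
    rw [Matrix.dotProduct_mulVec, ← Matrix.mulVec_transpose, hT, hSv]; simp [e]
  have h2 : e ⬝ᵥ S.mulVec e = S i i := by simp [e]
  have h3 : v ⬝ᵥ p = ∑ k, ∑ l, S⁻¹ k l * p k * p l := by
    simp only [dotProduct, hv, Matrix.mulVec, Finset.sum_mul]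
    exact Finset.sum_congr rfl fun k _ => Finset.sum_congr rfl fun l _ => by ring
  have h4 : e ⬝ᵥ p = p i := by simp [e]
  have h := hS.posSemidef.dotProduct_mulVec_nonneg (v - (p i / S i i) • e)
  simp only [star_trivial, Matrix.mulVec_sub, Matrix.mulVec_smul, hSv, sub_dotProduct,
    dotProduct_sub, smul_dotProduct, dotProduct_smul, h1, h2, h3, h4, smul_eq_mul] at h
  have h5 := mul_nonneg hii.le h
  have h6 : S i i * (∑ k, ∑ l, S⁻¹ k l * p k * p l - p i / S i i * p i -
      (p i / S i i * p i - p i / S i i * (p i / S i i * S i i))) =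
      S i i * ∑ k, ∑ l, S⁻¹ k l * p k * p l - p i ^ 2 := by
    field_simp
    ring
  linarith

section AsympFlat

variable {n : ℕ} {σ : EuclideanSpace ℝ (Fin n) → Matrix (Fin n) (Fin n) ℝ} {R₀ C : ℝ} {ω : ℝ → ℝ}

theorem IsAsympFlat.tendsto_radialTrace (h : IsAsympFlat σ R₀ C ω) :
    Tendsto (fun q : EuclideanSpace ℝ (Fin n) × (Fin n → ℝ) => radialTrace σ q.2 q.1)
      (Bornology.cobounded _ ×ˢ 𝓝 0) (𝓝 n) := by
  have h1 := tendsto_finsetSum Finset.univ fun i _ => h.tendsto_graphCoeff i i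
  have h2 := tendsto_finsetSum Finset.univ fun i _ => tendsto_finsetSum Finset.univ fun j _ =>
    (h.tendsto_graphCoeff i j).mul ((h.tendsto_radialChristoffel i j).comp
      (tendsto_fst (g := 𝓝 (0 : Fin n → ℝ))))
  simpa [radialTrace] using h1.sub h2

theorem abs_sum_mul_coord_sub_le {n : ℕ} (G : Fin n → Fin n → ℝ)
    (x : EuclideanSpace ℝ (Fin n)) :
    |∑ i, ∑ j, G i j * (x i * x j) - ‖x‖ ^ 2| ≤
      (∑ i, ∑ j, |G i j - (1 : Matrix (Fin n) (Fin n) ℝ) i j|) * ‖x‖ ^ 2 := by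
  have h1 : ‖x‖ ^ 2 = ∑ i, ∑ j, (1 : Matrix (Fin n) (Fin n) ℝ) i j * (x i * x j) := by
    rw [EuclideanSpace.real_norm_sq_eq]
    simp [Matrix.one_apply, pow_two]
  have hx (i : Fin n) : |x i| ≤ ‖x‖ := PiLp.norm_apply_le x i
  conv_lhs => rw [h1]
  simp only [← Finset.sum_sub_distrib, Finset.sum_mul]
  refine (Finset.abs_sum_le_sum_abs _ _).trans (Finset.sum_le_sum fun i _ => ?_)
  refine (Finset.abs_sum_le_sum_abs _ _).trans (Finset.sum_le_sum fun j _ => ?_)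
  rw [← sub_mul, abs_mul, abs_mul, pow_two]
  gcongr
  · exact hx i
  · exact hx j

theorem IsAsympFlat.exists_far_estimates (h : IsAsympFlat σ R₀ C ω) (hn : 3 ≤ n) :
    ∃ R₁ κ : ℝ, 1 ≤ R₁ ∧ 0 < κ ∧ ∀ (x : EuclideanSpace ℝ (Fin n)) (p : Fin n → ℝ), R₁ ≤ ‖x‖ →
      (∀ i, |p i| ≤ κ) → 29 / 10 ≤ radialTrace σ p x ∧ radialTrace σ p x ≤ n + 1 ∧
        0 ≤ ∑ i, ∑ j, graphCoeff (σ x) p i j * (x i * x j) ∧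
        ∑ i, ∑ j, graphCoeff (σ x) p i j * (x i * x j) ≤ 11 / 10 * ‖x‖ ^ 2 := by
  have hn' : (3 : ℝ) ≤ n := by exact_mod_cast hn
  have h1 := h.tendsto_radialTrace.eventually_mem (_root_.Icc_mem_nhds
    (show (29 / 10 : ℝ) < n by linarith) (show (n : ℝ) < n + 1 by linarith))
  have h2 := tendsto_finsetSum Finset.univ fun i _ => tendsto_finsetSum Finset.univ fun j _ =>
    ((h.tendsto_graphCoeff i j).sub_const ((1 : Matrix (Fin n) (Fin n) ℝ) i j)).abs
  simp only [sub_self, abs_zero, Finset.sum_const_zero] at h2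
  have h3 := h1.and (h2.eventually (gt_mem_nhds (show (0 : ℝ) < 1 / 10 by norm_num)))
  obtain ⟨P, hP, Q, hQ, hPQ⟩ := eventually_prod_iff.1 h3
  obtain ⟨r, -, hr⟩ := (hasBasis_cobounded_norm (E := EuclideanSpace ℝ (Fin n))).eventually_iff.1 hP
  obtain ⟨κ, hκ, hκQ⟩ := Metric.nhds_basis_closedBall.eventually_iff.1 hQ
  refine ⟨max 1 r, κ, le_max_left _ _, hκ, fun x p hx hp => ?_⟩
  obtain ⟨⟨ha, hb⟩, hc⟩ := hPQ (hr ((le_max_right _ _).trans hx)) (hκQ (x := p) (by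
    simpa [pi_norm_le_iff_of_nonneg hκ.le] using hp))
  have hd := (abs_sum_mul_coord_sub_le (graphCoeff (σ x) p) x).trans
    (mul_le_mul_of_nonneg_right hc.le (sq_nonneg _))
  have he := abs_le.1 hd
  have hf := sq_nonneg ‖x‖
  exact ⟨ha, hb, by linarith, by linarith⟩

theorem IsAsympFlat.exists_covector_bound (h : IsAsympFlat σ R₀ C ω) :
    ∃ P, 0 ≤ P ∧ ∀ (x : EuclideanSpace ℝ (Fin n)) (p : Fin n → ℝ),
      ∑ k, ∑ l, (σ x)⁻¹ k l * p k * p l ≤ 1 → ∀ i, |p i| ≤ P := by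
  obtain ⟨B, hB0, hB⟩ := exists_uniform_bound fun i : Fin n =>
    exists_bound_of_tendsto_cobounded (h.continuous.matrix_elem i i)
      (tendsto_pi_nhds.1 (tendsto_pi_nhds.1 h.tendsto i) i)
  refine ⟨√B, Real.sqrt_nonneg B, fun x p hp i => Real.abs_le_sqrt ?_⟩
  calc p i ^ 2 ≤ σ x i i * ∑ k, ∑ l, (σ x)⁻¹ k l * p k * p l :=
        sq_le_diag_mul_inv_form (h.posDef x) p i
    _ ≤ σ x i i * 1 := mul_le_mul_of_nonneg_left hp (h.posDef x).diag_pos.le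
    _ ≤ B := by simpa using (le_abs_self _).trans (hB i x)

theorem IsAsympFlat.exists_radialTrace_bound (h : IsAsympFlat σ R₀ C ω) {μ : ℝ} (hμ : 0 < μ) :
    ∃ K, 0 ≤ K ∧ ∀ (x : EuclideanSpace ℝ (Fin n)) (p : Fin n → ℝ),
      ∑ k, ∑ l, (σ x)⁻¹ k l * p k * p l ≤ 1 - μ → radialTrace σ p x ≤ K := by
  obtain ⟨P, hP0, hP⟩ := h.exists_covector_bound
  obtain ⟨B, hB0, hB⟩ := exists_uniform_bound fun ij : Fin n × Fin n =>
    exists_bound_of_tendsto_cobounded (h.continuous_inv.matrix_elem ij.1 ij.2)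
      (h.tendsto_inv_apply ij.1 ij.2)
  obtain ⟨D, hD0, hD⟩ := exists_uniform_bound fun ij : Fin n × Fin n =>
    exists_bound_of_tendsto_cobounded (h.continuous_radialChristoffel ij.1 ij.2)
      (h.tendsto_radialChristoffel ij.1 ij.2)
  set A : ℝ := B + (∑ _k : Fin n, ∑ _l : Fin n, B * B * P * P) / μ with hA
  have hA0 : 0 ≤ A := by positivity
  refine ⟨∑ _i : Fin n, A + ∑ _i : Fin n, ∑ _j : Fin n, A * D, by positivity, fun x p hp => ?_⟩
  have hpi := hP x p (hp.trans (by linarith))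
  have hG (i j : Fin n) : |graphCoeff (σ x) p i j| ≤ A := by
    refine (abs_add_le _ _).trans (add_le_add (hB (i, j) x) ?_)
    rw [abs_div]
    refine div_le_div₀ (by positivity) ?_ hμ ?_
    · refine (Finset.abs_sum_le_sum_abs _ _).trans (Finset.sum_le_sum fun k _ => ?_)
      refine (Finset.abs_sum_le_sum_abs _ _).trans (Finset.sum_le_sum fun l _ => ?_)
      simp only [abs_mul]
      have := hB (i, k) x
      have := hB (j, l) x
      have := hpi k
      have := hpi l
      gcongr
    · exact le_abs.2 (Or.inl (by linarith))
  rw [radialTrace, sub_eq_add_neg, ← Finset.sum_neg_distrib]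
  refine add_le_add (Finset.sum_le_sum fun i _ => (le_abs_self _).trans (hG i i))
    (Finset.sum_le_sum fun i _ => ?_)
  rw [← Finset.sum_neg_distrib]
  refine Finset.sum_le_sum fun j _ => (neg_le_abs _).trans ?_
  rw [abs_mul]
  exact mul_le_mul (hG i j) (hD (i, j) x) (abs_nonneg _) hA0

end AsympFlat

/-- `u` solves the graphical mean curvature flow on `[0, t₁]` with `|∇u|²_σ ≤ 1 − μ`. -/
structure IsSpacelikeMCF {n : ℕ} (σ : EuclideanSpace ℝ (Fin n) → Matrix (Fin n) (Fin n) ℝ)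
    (μ t₁ : ℝ) (u : ℝ → EuclideanSpace ℝ (Fin n) → ℝ) : Prop where
  continuousOn : ContinuousOn (fun p : ℝ × EuclideanSpace ℝ (Fin n) => u p.1 p.2)
    (Icc 0 t₁ ×ˢ univ)
  contDiff : ∀ t, 0 < t → t ≤ t₁ → ContDiff ℝ 2 (u t)
  hasDerivAt : ∀ x t, 0 < t → t ≤ t₁ → HasDerivAt (fun s => u s x) (mcfOp σ (u t) x) t
  gradSq_le : ∀ t, 0 < t → t ≤ t₁ → ∀ x, gradSq σ (u t) x ≤ 1 - μ

theorem pd_neg {n : ℕ} (f : EuclideanSpace ℝ (Fin n) → ℝ) (x : EuclideanSpace ℝ (Fin n))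
    (i : Fin n) : pd i (fun y => -f y) x = -pd i f x := by
  simp [pd, fderiv_fun_neg]

theorem gradSq_neg {n : ℕ} (σ : EuclideanSpace ℝ (Fin n) → Matrix (Fin n) (Fin n) ℝ)
    (f : EuclideanSpace ℝ (Fin n) → ℝ) (x : EuclideanSpace ℝ (Fin n)) :
    gradSq σ (fun y => -f y) x = gradSq σ f x := by
  simp [gradSq, pd_neg]

theorem mcfOp_neg {n : ℕ} (σ : EuclideanSpace ℝ (Fin n) → Matrix (Fin n) (Fin n) ℝ)
    (f : EuclideanSpace ℝ (Fin n) → ℝ) (x : EuclideanSpace ℝ (Fin n)) :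
    mcfOp σ (fun y => -f y) x = -mcfOp σ f x := by
  have h1 (i j : Fin n) : ginv σ (fun y => -f y) i j x = ginv σ f i j x := by
    simp [ginv, gradSq_neg, pd_neg]
  have h2 (i j : Fin n) : covHess σ (fun y => -f y) i j x = -covHess σ f i j x := by
    simp only [covHess, pd_neg, mul_neg, Finset.sum_neg_distrib]
    ring
  simp only [mcfOp, h1, h2, mul_neg, Finset.sum_neg_distrib]

theorem nonneg_of_hasDerivAt_of_left_max {f : ℝ → ℝ} {f' a t : ℝ} (hf : HasDerivAt f f' t)
    (hat : a < t) (h : ∀ s, a ≤ s → s ≤ t → f s ≤ f t) : 0 ≤ f' := by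
  have h1 := (hasDerivWithinAt_iff_tendsto_slope' (s := Iio t) self_notMem_Iio).1
    hf.hasDerivWithinAt
  refine ge_of_tendsto h1 ?_
  filter_upwards [Ioo_mem_nhdsLT hat] with s hs
  rw [slope_def_field]
  exact div_nonneg_of_nonpos (by linarith [h s hs.1.le hs.2.le]) (by linarith [hs.2])

section SpacelikeMCF

variable {n : ℕ} {σ : EuclideanSpace ℝ (Fin n) → Matrix (Fin n) (Fin n) ℝ} {μ t₁ : ℝ}
  {u : ℝ → EuclideanSpace ℝ (Fin n) → ℝ}

theorem IsSpacelikeMCF.neg (hu : IsSpacelikeMCF σ μ t₁ u) :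
    IsSpacelikeMCF σ μ t₁ (fun t x => -u t x) where
  continuousOn := hu.continuousOn.neg
  contDiff t h0 h1 := (hu.contDiff t h0 h1).neg
  hasDerivAt x t h0 h1 := by
    rw [mcfOp_neg]
    exact (hu.hasDerivAt x t h0 h1).neg
  gradSq_le t h0 h1 x := by
    rw [gradSq_neg]
    exact hu.gradSq_le t h0 h1 x

theorem IsSpacelikeMCF.le_barrier (hu : IsSpacelikeMCF σ μ t₁ u) (hσ : ∀ x, (σ x).PosDef)
    (hμ : 0 < μ) {D : Set (EuclideanSpace ℝ (Fin n))} (hD : IsClosed D)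
    {w : EuclideanSpace ℝ (Fin n) → ℝ} {c ρ : ℝ} (hw : ContinuousOn w D)
    (hw2 : ∀ x ∈ interior D, ContDiffAt ℝ 2 w x)
    (hinit : ∀ x ∈ D, u 0 x ≤ w x)
    (hbdry : ∀ x ∈ D, x ∉ interior D → ∀ t ∈ Icc 0 t₁, u t x ≤ w x + c * t)
    (hfar : ∀ x ∈ D, ρ ≤ ‖x‖ → ∀ t ∈ Icc 0 t₁, u t x ≤ w x + c * t)
    (hsuper : ∀ x ∈ interior D, ∀ t, 0 < t → t ≤ t₁ → (∀ i, pd i (u t) x = pd i w x) →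
      ∑ i, ∑ j, ginv σ (u t) i j x * covHess σ w i j x < c) :
    ∀ x ∈ D, ∀ t ∈ Icc 0 t₁, u t x ≤ w x + c * t := by
  intro x₀ hx₀ t₀ ht₀
  by_contra! hpos
  set v : ℝ × EuclideanSpace ℝ (Fin n) → ℝ := fun p => u p.1 p.2 - (w p.2 + c * p.1) with hv
  set K : Set (ℝ × EuclideanSpace ℝ (Fin n)) := Icc 0 t₁ ×ˢ (D ∩ closedBall 0 ρ) with hK
  have hx₀ρ : ‖x₀‖ < ρ := by
    by_contra! h
    exact absurd (hfar x₀ hx₀ h t₀ ht₀) hpos.not_ge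
  have hKc : IsCompact K := isCompact_Icc.prod ((isCompact_closedBall 0 ρ).inter_left hD)
  have hvc : ContinuousOn v K := by
    refine (hu.continuousOn.mono (prod_mono_right (subset_univ _))).sub (ContinuousOn.add ?_ ?_)
    · exact hw.comp continuousOn_snd fun p hp => hp.2.1
    · exact (continuous_const.mul continuous_fst).continuousOn
  have hmem₀ : (t₀, x₀) ∈ K := ⟨ht₀, hx₀, by simpa using hx₀ρ.le⟩
  obtain ⟨⟨t, x⟩, ⟨ht, hxD, hxρ⟩, hmax⟩ := hKc.exists_isMaxOn ⟨_, hmem₀⟩ hvc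
  have hvpos : 0 < u t x - (w x + c * t) :=
    lt_of_lt_of_le (by simp only [hv]; linarith) (hmax hmem₀)
  have ht0 : 0 < t := by
    refine lt_of_le_of_ne ht.1 fun h => ?_
    rw [← h] at hvpos
    linarith [hinit x hxD]
  have hxint : x ∈ interior D := by
    by_contra h
    linarith [hbdry x hxD h t ht]
  have hxρ' : ‖x‖ < ρ := by
    by_contra! h
    linarith [hfar x hxD h t ht]
  have hlocal : IsLocalMax (fun y => u t y - w y) x := by
    filter_upwards [isOpen_interior.mem_nhds hxint,
      isOpen_lt continuous_norm continuous_const |>.mem_nhds hxρ'] with y hy1 hy2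
    have h1 : (t, y) ∈ K := ⟨ht, interior_subset hy1, by simpa using le_of_lt hy2⟩
    have h2 : v (t, y) ≤ v (t, x) := hmax h1
    simp only [hv] at h2
    linarith
  have hgrad : gradSq σ (u t) x < 1 := (hu.gradSq_le t ht0 ht.2 x).trans_lt (by linarith)
  obtain ⟨hpd, hle⟩ := mcfOp_le_of_isLocalMax_sub (hσ x) (hu.contDiff t ht0 ht.2).contDiffAt
    (hw2 x hxint) hgrad hlocal
  have hlt := hsuper x hxint t ht0 ht.2 hpd
  have hderiv : HasDerivAt (fun s => v (s, x)) (mcfOp σ (u t) x - c) t := by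
    have h1 := (((hasDerivAt_id t).const_mul c).const_add (w x))
    rw [mul_one] at h1
    exact (hu.hasDerivAt x t ht0 ht.2).sub h1
  have := nonneg_of_hasDerivAt_of_left_max hderiv ht0 fun s hs0 hst =>
    hmax (show (s, x) ∈ K from ⟨⟨hs0, hst.trans ht.2⟩, hxD, hxρ⟩)
  linarith

theorem le_of_forall_small_mul {a b c κ : ℝ} (hκ : 0 < κ)
    (h : ∀ ε, 0 < ε → ε ≤ κ → a ≤ b + ε * c) : a ≤ b := by
  have h1 : Tendsto (fun ε : ℝ => b + ε * c) (𝓝[>] 0) (𝓝 b) := by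
    have : Continuous fun ε : ℝ => b + ε * c := by fun_prop
    simpa using (this.tendsto 0).mono_left nhdsWithin_le_nhds
  refine ge_of_tendsto h1 ?_
  filter_upwards [Ioc_mem_nhdsGT hκ] with ε hε using h ε hε.1 hε.2

variable {R₀ C : ℝ} {ω : ℝ → ℝ}

theorem IsSpacelikeMCF.linear_growth (hu : IsSpacelikeMCF σ μ t₁ u)
    (hσ : IsAsympFlat σ R₀ C ω) (hμ : 0 < μ) {M : ℝ} (h0 : ∀ x, |u 0 x| ≤ M) :
    ∃ A L : ℝ, 0 ≤ A ∧ 0 ≤ L ∧ ∀ t ∈ Icc 0 t₁, ∀ x, u t x ≤ A + L * ‖x‖ := by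
  obtain ⟨P, hP0, hP⟩ := hσ.exists_covector_bound
  obtain ⟨A, hA⟩ := (isCompact_Icc (a := (0 : ℝ)) (b := t₁)).exists_bound_of_continuousOn
    (f := fun t => u t 0)
    (hu.continuousOn.comp (f := fun t : ℝ => (t, (0 : EuclideanSpace ℝ (Fin n))))
      (by fun_prop) fun t ht => ⟨ht, mem_univ _⟩)
  refine ⟨max M |A|, n * P, le_max_of_le_right (abs_nonneg A), by positivity, fun t ht x => ?_⟩
  rcases ht.1.eq_or_lt with rfl | htpos
  · have h1 := (le_abs_self _).trans (h0 x)
    have h2 : 0 ≤ n * P * ‖x‖ := by positivity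
    linarith [le_max_left M |A|]
  have hbound (y : EuclideanSpace ℝ (Fin n)) : ‖fderiv ℝ (u t) y‖ ≤ n * P := by
    refine ContinuousLinearMap.opNorm_le_bound _ (by positivity) fun v => ?_
    have hpd := hP y (fun k => pd k (u t) y)
      ((hu.gradSq_le t htpos ht.2 y).trans (by linarith))
    rw [fderiv_apply_eq_sum_pd]
    refine (norm_sum_le _ _).trans ?_
    calc ∑ i, ‖v i * pd i (u t) y‖ ≤ ∑ _i : Fin n, ‖v‖ * P := by
          refine Finset.sum_le_sum fun i _ => ?_
          rw [norm_mul]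
          exact mul_le_mul (PiLp.norm_apply_le v i) (hpd i) (norm_nonneg _) (norm_nonneg _)
      _ = n * P * ‖v‖ := by simp; ring
  have h1 := (convex_univ (𝕜 := ℝ)).norm_image_sub_le_of_norm_fderiv_le (f := u t) (x := 0) (y := x)
    (fun y _ => (hu.contDiff t htpos ht.2).differentiable (by norm_num) y)
    (fun y _ => hbound y) (mem_univ _) (mem_univ _)
  rw [sub_zero] at h1
  have h2 := (le_abs_self _).trans h1
  have h3 := (le_abs_self _).trans (hA t ht)
  linarith [le_max_right M |A|, le_abs_self A]

theorem IsSpacelikeMCF.le_of_initial_bound (hu : IsSpacelikeMCF σ μ t₁ u)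
    (hσ : IsAsympFlat σ R₀ C ω) (hμ : 0 < μ) {M : ℝ} (h0 : ∀ x, |u 0 x| ≤ M) :
    ∀ t ∈ Icc 0 t₁, ∀ x, u t x ≤ M := by
  intro t ht x
  obtain ⟨A, L, hA, hL, hAL⟩ := hu.linear_growth hσ hμ h0
  obtain ⟨K, hK0, hK⟩ := hσ.exists_radialTrace_bound hμ
  have hM : 0 ≤ M := (abs_nonneg _).trans (h0 0)
  refine le_of_forall_small_mul (c := ‖x‖ ^ 2 + (2 * K + 1) * t) one_pos fun ε hε _ => ?_
  have key := hu.le_barrier hσ.posDef hμ (D := univ) isClosed_univ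
    (w := fun y => M + ε * ‖y‖ ^ 2) (c := ε * (2 * K + 1)) (ρ := max 1 ((A + L) / ε))
    (by fun_prop)
    (fun y _ => contDiffAt_const.add (contDiffAt_const.mul (contDiff_norm_sq ℝ).contDiffAt))
    (fun y _ => by
      have := (le_abs_self _).trans (h0 y)
      have : 0 ≤ ε * ‖y‖ ^ 2 := by positivity
      linarith)
    (fun y _ hy => by simp at hy)
    (fun y _ hy s hs => by
      have h1 := hAL s hs y
      have hy1 := (le_max_left _ _).trans hy
      have h2 : A + L ≤ ‖y‖ * ε := (div_le_iff₀ hε).1 ((le_max_right _ _).trans hy)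
      have h3 : 0 ≤ ε * (2 * K + 1) * s := by have := hs.1; positivity
      nlinarith)
    (fun y _ s hs hs1 _ => by
      have h1 := sum_mul_covHess_comp_norm_sq σ (F := fun r => M + ε * r) (F' := fun _ => ε)
        (F'' := 0) (x := y)
        (Eventually.of_forall fun r => by
          simpa using ((hasDerivAt_id r).const_mul ε).const_add M)
        (hasDerivAt_const _ _) (fun i j => ginv σ (u s) i j y)
      have h2 := hK y (fun k => pd k (u s) y) (hu.gradSq_le s hs hs1 y)
      simp only [radialTrace, ← ginv_eq_graphCoeff] at h2
      rw [h1]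
      nlinarith)
    x (mem_univ _) t ht
  calc u t x ≤ _ := key
    _ = _ := by ring

end SpacelikeMCF

section Decay

variable {n : ℕ} {σ : EuclideanSpace ℝ (Fin n) → Matrix (Fin n) (Fin n) ℝ} {μ t₁ : ℝ}
  {u : ℝ → EuclideanSpace ℝ (Fin n) → ℝ} {R₀ C : ℝ} {ω : ℝ → ℝ}

theorem hasDerivAt_barrierProfile (δ A ε : ℝ) {s : ℝ} (hs : 0 < s) :
    HasDerivAt (fun s : ℝ => δ + A * s ^ (-1 / 4 : ℝ) + ε * s ^ (1 / 2 : ℝ))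
      ((-A / 4 * s ^ (-1 / 4 : ℝ) + ε / 2 * s ^ (1 / 2 : ℝ)) * s⁻¹) s := by
  have h1 := ((Real.hasDerivAt_rpow_const (p := -1 / 4) (Or.inl hs.ne')).const_mul A).const_add δ
  have h2 := (Real.hasDerivAt_rpow_const (p := 1 / 2) (Or.inl hs.ne')).const_mul ε
  convert! h1.add h2 using 1
  rw [Real.rpow_sub_one hs.ne', Real.rpow_sub_one hs.ne']
  ring

theorem hasDerivAt_barrierProfile_deriv (A ε : ℝ) {s : ℝ} (hs : 0 < s) :
    HasDerivAt (fun s : ℝ => (-A / 4 * s ^ (-1 / 4 : ℝ) + ε / 2 * s ^ (1 / 2 : ℝ)) * s⁻¹)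
      ((5 * A / 16 * s ^ (-1 / 4 : ℝ) - ε / 4 * s ^ (1 / 2 : ℝ)) * (s ^ 2)⁻¹) s := by
  have h1 := (Real.hasDerivAt_rpow_const (p := -1 / 4) (Or.inl hs.ne')).const_mul (-A / 4)
  have h2 := (Real.hasDerivAt_rpow_const (p := 1 / 2) (Or.inl hs.ne')).const_mul (ε / 2)
  convert! (h1.fun_add h2).fun_mul (hasDerivAt_inv hs.ne') using 1
  rw [Real.rpow_sub_one hs.ne', Real.rpow_sub_one hs.ne']
  field_simp
  ring

/-- The radial barrier is a strict supersolution once the coefficients are nearly Euclidean. -/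
theorem barrier_operator_lt {B q a s ε ν e : ℝ} (hB : 0 ≤ B) (hs : 0 < s)
    (hes : e ≤ s) (hε : 0 < ε) (ha : 29 / 10 ≤ a) (ha' : a ≤ ν + 1) (hq : 0 ≤ q)
    (hq' : q ≤ 11 / 10 * s) :
    2 * ((-B / 4 + ε / 2 * e) * s⁻¹) * a + 4 * ((5 * B / 16 - ε / 4 * e) * (s ^ 2)⁻¹) * q <
      ε * (ν + 2) := by
  have h1 : 2 * ((-B / 4 + ε / 2 * e) * s⁻¹) * a +
      4 * ((5 * B / 16 - ε / 4 * e) * (s ^ 2)⁻¹) * q =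
      B / 4 * s⁻¹ * (5 * (q / s) - 2 * a) + ε * (e / s) * (a - q / s) := by
    field_simp
    ring
  have hqs : q / s ≤ 11 / 10 := (div_le_iff₀ hs).2 hq'
  have hqs0 : 0 ≤ q / s := div_nonneg hq hs.le
  have h2 : B / 4 * s⁻¹ * (5 * (q / s) - 2 * a) ≤ 0 :=
    mul_nonpos_of_nonneg_of_nonpos (by positivity) (by linarith)
  have h3 : ε * (e / s) * (a - q / s) ≤ ε * 1 * (ν + 1) :=
    mul_le_mul (mul_le_mul_of_nonneg_left ((div_le_one hs).2 hes) hε.le) (by linarith)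
      (by linarith) (by linarith)
  rw [h1]
  linarith

theorem IsSpacelikeMCF.le_decay (hu : IsSpacelikeMCF σ μ t₁ u) (hσ : IsAsympFlat σ R₀ C ω)
    (hμ : 0 < μ) {R₁ κ : ℝ} (hR₁ : 1 ≤ R₁) (hκ : 0 < κ)
    (hest : ∀ (x : EuclideanSpace ℝ (Fin n)) (p : Fin n → ℝ), R₁ ≤ ‖x‖ →
      (∀ i, |p i| ≤ κ) → 29 / 10 ≤ radialTrace σ p x ∧ radialTrace σ p x ≤ n + 1 ∧
        0 ≤ ∑ i, ∑ j, graphCoeff (σ x) p i j * (x i * x j) ∧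
        ∑ i, ∑ j, graphCoeff (σ x) p i j * (x i * x j) ≤ 11 / 10 * ‖x‖ ^ 2)
    {M δ R : ℝ} (hR : R₁ ≤ R) (hMR : M ≤ κ * R) (hδ : 0 ≤ δ) (h0 : ∀ x, |u 0 x| ≤ M)
    (h0δ : ∀ x : EuclideanSpace ℝ (Fin n), R ≤ ‖x‖ → u 0 x ≤ δ) :
    ∀ t ∈ Icc 0 t₁, ∀ x : EuclideanSpace ℝ (Fin n), R ≤ ‖x‖ →
      u t x ≤ δ + M * (R ^ 2) ^ (1 / 4 : ℝ) * (‖x‖ ^ 2) ^ (-1 / 4 : ℝ) := by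
  intro t ht x hx
  have hM : 0 ≤ M := (abs_nonneg _).trans (h0 0)
  have hRpos : 0 < R := by linarith
  set A : ℝ := M * (R ^ 2) ^ (1 / 4 : ℝ) with hA
  have hA0 : 0 ≤ A := by positivity
  have hAle (y : EuclideanSpace ℝ (Fin n)) (hy : R ≤ ‖y‖) : A * (‖y‖ ^ 2) ^ (-1 / 4 : ℝ) ≤ M := by
    have hy0 : 0 < ‖y‖ := hRpos.trans_le hy
    have h1 : (R ^ 2) ^ (1 / 4 : ℝ) ≤ (‖y‖ ^ 2) ^ (1 / 4 : ℝ) := by gcongr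
    have h2 : (‖y‖ ^ 2) ^ (1 / 4 : ℝ) * (‖y‖ ^ 2) ^ (-1 / 4 : ℝ) = 1 := by
      rw [← Real.rpow_add (by positivity)]; norm_num
    calc A * (‖y‖ ^ 2) ^ (-1 / 4 : ℝ)
        ≤ M * (‖y‖ ^ 2) ^ (1 / 4 : ℝ) * (‖y‖ ^ 2) ^ (-1 / 4 : ℝ) := by rw [hA]; gcongr
      _ = M := by rw [mul_assoc, h2, mul_one]
  have hAeq (y : EuclideanSpace ℝ (Fin n)) (hy : ‖y‖ = R) :
      A * (‖y‖ ^ 2) ^ (-1 / 4 : ℝ) = M := by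
    rw [hA, hy, mul_assoc, ← Real.rpow_add (by positivity)]; norm_num
  have hsqrt (y : EuclideanSpace ℝ (Fin n)) : (‖y‖ ^ 2) ^ (1 / 2 : ℝ) = ‖y‖ := by
    rw [← Real.sqrt_eq_rpow, Real.sqrt_sq (norm_nonneg _)]
  have huM := hu.le_of_initial_bound hσ hμ h0
  refine le_of_forall_small_mul (c := ‖x‖ + (n + 2) * t) (half_pos hκ) fun ε hε hεκ => ?_
  set F : ℝ → ℝ := fun s => δ + A * s ^ (-1 / 4 : ℝ) + ε * s ^ (1 / 2 : ℝ) with hF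
  have hFy (y : EuclideanSpace ℝ (Fin n)) :
      F (‖y‖ ^ 2) = δ + A * (‖y‖ ^ 2) ^ (-1 / 4 : ℝ) + ε * ‖y‖ := by
    simp only [hF, hsqrt]
  set D : Set (EuclideanSpace ℝ (Fin n)) := {y | R ≤ ‖y‖} with hD
  have hDpos (y : EuclideanSpace ℝ (Fin n)) (hy : y ∈ D) : 0 < ‖y‖ ^ 2 := by
    have : 0 < ‖y‖ := hRpos.trans_le hy
    positivity
  have hDint : {y : EuclideanSpace ℝ (Fin n) | R < ‖y‖} ⊆ interior D :=
    interior_maximal (fun y (hy : R < ‖y‖) => hy.le) (isOpen_lt continuous_const continuous_norm)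
  have hsmooth (y : EuclideanSpace ℝ (Fin n)) (hy : y ∈ D) :
      ContDiffAt ℝ 2 (fun z => F (‖z‖ ^ 2)) y := by
    have h1 : ContDiffAt ℝ 2 (fun z : EuclideanSpace ℝ (Fin n) => ‖z‖ ^ 2) y :=
      (contDiff_norm_sq ℝ).contDiffAt
    exact (contDiffAt_const.add (contDiffAt_const.mul (h1.rpow_const_of_ne (hDpos y hy).ne'))).add
      (contDiffAt_const.mul (h1.rpow_const_of_ne (hDpos y hy).ne'))
  have hFderiv (y : EuclideanSpace ℝ (Fin n)) (hy : y ∈ D) : ∀ᶠ s in 𝓝 (‖y‖ ^ 2),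
      HasDerivAt F ((-A / 4 * s ^ (-1 / 4 : ℝ) + ε / 2 * s ^ (1 / 2 : ℝ)) * s⁻¹) s := by
    filter_upwards [lt_mem_nhds (hDpos y hy)] with s hs using hasDerivAt_barrierProfile δ A ε hs
  have key := hu.le_barrier hσ.posDef hμ (D := D) (isClosed_le continuous_const continuous_norm)
    (w := fun y => F (‖y‖ ^ 2)) (c := ε * (n + 2)) (ρ := M / ε)
    (fun y hy => (hsmooth y hy).continuousAt.continuousWithinAt)
    (fun y hy => hsmooth y (interior_subset hy))
    (fun y hy => by
      have h1 := h0δ y hy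
      have h2 : 0 ≤ A * (‖y‖ ^ 2) ^ (-1 / 4 : ℝ) + ε * ‖y‖ := by positivity
      rw [hFy]
      linarith)
    (fun y hy hyi s hs => by
      have h1 : ‖y‖ = R := le_antisymm (not_lt.1 fun h => hyi (hDint h)) hy
      have h2 : 0 ≤ ε * ‖y‖ + ε * (n + 2) * s := by have := hs.1; positivity
      rw [hFy, hAeq y h1]
      linarith [huM s hs y])
    (fun y hy hyρ s hs => by
      have h1 : M ≤ ‖y‖ * ε := (div_le_iff₀ hε).1 hyρ
      have h2 : 0 ≤ A * (‖y‖ ^ 2) ^ (-1 / 4 : ℝ) + ε * (n + 2) * s := by have := hs.1; positivity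
      rw [hFy]
      linarith [huM s hs y])
    (fun y hyi s hs hs1 hpd => by
      have hy : y ∈ D := interior_subset hyi
      have hyR : R ≤ ‖y‖ := hy
      have hs0 := hDpos y hy
      have hy0 : 0 < ‖y‖ := hRpos.trans_le hyR
      have hp (i : Fin n) : |pd i (u s) y| ≤ κ := by
        rw [hpd i, pd_comp_norm_sq (hFderiv y hy).self_of_nhds, hsqrt, abs_mul, abs_mul, abs_mul, abs_inv, abs_of_pos hs0, abs_two]
        have h1 : |-A / 4 * (‖y‖ ^ 2) ^ (-1 / 4 : ℝ) + ε / 2 * ‖y‖| ≤ κ / 2 * ‖y‖ := by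
          have h2 : M ≤ κ * ‖y‖ := hMR.trans (by gcongr)
          have h3 : ε * ‖y‖ ≤ κ / 2 * ‖y‖ := by gcongr
          have h4 : 0 ≤ ε * ‖y‖ := by positivity
          have h5 := hAle y hyR
          have h6 : 0 ≤ A * (‖y‖ ^ 2) ^ (-1 / 4 : ℝ) := by positivity
          rw [abs_le]
          constructor <;> linarith
        calc 2 * (|-A / 4 * (‖y‖ ^ 2) ^ (-1 / 4 : ℝ) + ε / 2 * ‖y‖| * (‖y‖ ^ 2)⁻¹) * |y i|
            ≤ 2 * (κ / 2 * ‖y‖ * (‖y‖ ^ 2)⁻¹) * ‖y‖ := by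
              have := PiLp.norm_apply_le y i
              rw [Real.norm_eq_abs] at this
              gcongr
          _ = κ := by field_simp
      obtain ⟨h1, h2, h3, h4⟩ := hest y (fun k => pd k (u s) y) (hR.trans hyR) hp
      have h5 := sum_mul_covHess_comp_norm_sq σ (hFderiv y hy)
        (hasDerivAt_barrierProfile_deriv A ε hs0) (graphCoeff (σ y) fun k => pd k (u s) y)
      simp only [ginv_eq_graphCoeff]
      rw [h5]
      have h6 := barrier_operator_lt (B := A * (‖y‖ ^ 2) ^ (-1 / 4 : ℝ))
        (e := (‖y‖ ^ 2) ^ (1 / 2 : ℝ)) (by positivity) hs0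
        (by rw [hsqrt]; nlinarith) hε h1 h2 h3 h4
      refine lt_of_eq_of_lt ?_ h6
      rw [radialTrace]
      ring)
    x hx t ht
  rw [hFy] at key
  calc u t x ≤ _ := key
    _ = _ := by ring

theorem exists_uniform_decay (hn : 3 ≤ n) (hσ : IsAsympFlat σ R₀ C ω)
    {u₀ : EuclideanSpace ℝ (Fin n) → ℝ} {M : ℝ} (hM : ∀ x, |u₀ x| ≤ M)
    (hdecay : ∀ δ : ℝ, 0 < δ →
      ∃ Rδ : ℝ, ∀ x : EuclideanSpace ℝ (Fin n), Rδ ≤ ‖x‖ → |u₀ x| ≤ δ)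
    {δ : ℝ} (hδ : 0 < δ) :
    ∃ Rδ : ℝ, ∀ (μ t : ℝ) (u : ℝ → EuclideanSpace ℝ (Fin n) → ℝ), 0 < μ → 0 < t →
      IsSpacelikeMCF σ μ t u → u 0 = u₀ →
      ∀ x : EuclideanSpace ℝ (Fin n), Rδ ≤ ‖x‖ → |u t x| ≤ δ := by
  obtain ⟨R₁, κ, hR₁, hκ, hest⟩ := hσ.exists_far_estimates hn
  obtain ⟨R₂, hR₂⟩ := hdecay (δ / 2) (half_pos hδ)
  set R := max R₁ (max R₂ (M / κ)) with hR
  have hMR : M ≤ κ * R := by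
    rw [mul_comm, ← div_le_iff₀ hκ]
    exact (le_max_right _ _).trans (le_max_right _ _)
  have hR2R : R₂ ≤ R := (le_max_left _ _).trans (le_max_right _ _)
  have hlim : Tendsto (fun r : ℝ => M * (R ^ 2) ^ (1 / 4 : ℝ) * (r ^ 2) ^ (-1 / 4 : ℝ))
      atTop (𝓝 0) := by
    have h1 := (tendsto_rpow_neg_atTop (y := 1 / 4) (by norm_num)).comp
      (tendsto_pow_atTop (α := ℝ) (n := 2) two_ne_zero)
    simpa [Function.comp_def, neg_div] using h1.const_mul (M * (R ^ 2) ^ (1 / 4 : ℝ))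
  obtain ⟨R₃, hR₃⟩ := eventually_atTop.1 (hlim.eventually (gt_mem_nhds (half_pos hδ)))
  refine ⟨max R R₃, fun μ t u hμ ht hu hu0 x hx => ?_⟩
  have hxR := (le_max_left _ _).trans hx
  have hx3 := hR₃ ‖x‖ ((le_max_right _ _).trans hx)
  have hmem : t ∈ Icc 0 t := ⟨ht.le, le_rfl⟩
  have h1 := hu.le_decay hσ hμ hR₁ hκ hest (le_max_left _ _) hMR (half_pos hδ).le
    (by rw [hu0]; exact hM)
    (fun y hy => by rw [hu0]; exact (le_abs_self _).trans (hR₂ y (hR2R.trans hy))) t hmem x hxR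
  have h2 := hu.neg.le_decay hσ hμ hR₁ hκ hest (le_max_left _ _) hMR (half_pos hδ).le
    (by rw [hu0]; simpa using hM)
    (fun y hy => by rw [hu0]; exact (neg_le_abs _).trans (hR₂ y (hR2R.trans hy))) t hmem x hxR
  rw [abs_le]
  constructor <;> linarith

end Decay

/-- A uniformly bounded and uniformly vanishing family of functions has a common barrier. -/
theorem exists_common_barrier {E : Type*} [SeminormedAddCommGroup E] {S : Set (E → ℝ)} {M : ℝ}
    (hM : ∀ f ∈ S, ∀ x, |f x| ≤ M)
    (hS : ∀ δ : ℝ, 0 < δ → ∃ R : ℝ, ∀ f ∈ S, ∀ x, R ≤ ‖x‖ → |f x| ≤ δ) :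
    ∃ b : E → ℝ, (∀ x, 0 < b x) ∧ (∀ δ : ℝ, 0 < δ → ∃ R : ℝ, ∀ x, R ≤ ‖x‖ → b x ≤ δ) ∧
      ∀ f ∈ S, ∀ x, |f x| ≤ b x := by
  refine ⟨fun x => sSup ((fun f => |f x|) '' S) + (1 + ‖x‖)⁻¹, fun x => ?_, fun δ hδ => ?_,
    fun f hf x => ?_⟩
  · refine add_pos_of_nonneg_of_pos (Real.sSup_nonneg ?_) (by positivity)
    rintro _ ⟨f, -, rfl⟩
    exact abs_nonneg _
  · obtain ⟨R, hR⟩ := hS (δ / 2) (half_pos hδ)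
    refine ⟨max R (2 / δ), fun x hx => ?_⟩
    have h1 : sSup ((fun f => |f x|) '' S) ≤ δ / 2 := by
      refine Real.sSup_le ?_ (half_pos hδ).le
      rintro _ ⟨f, hf, rfl⟩
      exact hR f hf x ((le_max_left _ _).trans hx)
    have h2 : (1 + ‖x‖)⁻¹ ≤ δ / 2 := by
      rw [← inv_div 2 δ]
      have h3 := (le_max_right _ _).trans hx
      exact inv_anti₀ (by positivity) (by linarith)
    linarith
  · have h1 : |f x| ≤ sSup ((fun f => |f x|) '' S) := by
      refine le_csSup ⟨M, ?_⟩ ⟨f, hf, rfl⟩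
      rintro _ ⟨g, hg, rfl⟩
      exact hM g hg x
    have h2 : 0 < (1 + ‖x‖)⁻¹ := by positivity
    linarith

/- STATEMENT 9: No lift-off for arbitrary uniformly spacelike entire solutions of the
graphical mean curvature flow on an asymptotically flat ℝⁿ (n ≥ 3): if u₀ is bounded and
Lipschitz with u₀ → 0 at infinity, then every uniformly spacelike C^{2;1} ∩ C⁰ solution u
with u(·,0) = u₀ satisfies u(·,t) → 0 at spatial infinity for every t ∈ (0,T), and there
is a barrier b, depending only on u₀ and σ, with |u(x,t)| ≤ b(x) and b → 0 at infinity. -/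
theorem stmt_9 (n : ℕ) (hn : 3 ≤ n)
    (σ : EuclideanSpace ℝ (Fin n) → Matrix (Fin n) (Fin n) ℝ) (R₀ C : ℝ) (ω : ℝ → ℝ)
    (hσ : IsAsympFlat σ R₀ C ω)
    (u₀ : EuclideanSpace ℝ (Fin n) → ℝ)
    (hbd : ∃ M : ℝ, ∀ x, |u₀ x| ≤ M)
    (hlip : ∃ L : ℝ, ∀ x y : EuclideanSpace ℝ (Fin n), |u₀ x - u₀ y| ≤ L * ‖x - y‖)
    (hdecay : ∀ δ : ℝ, 0 < δ →
      ∃ Rδ : ℝ, ∀ x : EuclideanSpace ℝ (Fin n), Rδ ≤ ‖x‖ → |u₀ x| ≤ δ) :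
    ∃ b : EuclideanSpace ℝ (Fin n) → ℝ,
      (∀ x, 0 < b x) ∧
      (∀ δ : ℝ, 0 < δ → ∃ Rδ : ℝ, ∀ x : EuclideanSpace ℝ (Fin n), Rδ ≤ ‖x‖ → b x ≤ δ) ∧
      ∀ (T : ℝ≥0∞), 0 < T → ∀ μ : ℝ, 0 < μ →
        ∀ u : ℝ → EuclideanSpace ℝ (Fin n) → ℝ,
          -- u ∈ C⁰(ℝⁿ × [0,T))
          ContinuousOn (fun p : ℝ × EuclideanSpace ℝ (Fin n) => u p.1 p.2)
            ({t | 0 ≤ t ∧ ENNReal.ofReal t < T} ×ˢ Set.univ) →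
          -- u ∈ C^{2;1}(ℝⁿ × (0,T)) and u solves the graphical mean curvature flow
          (∀ t : ℝ, 0 < t → ENNReal.ofReal t < T → ContDiff ℝ 2 (u t)) →
          (∀ (x : EuclideanSpace ℝ (Fin n)) (t : ℝ), 0 < t → ENNReal.ofReal t < T →
            HasDerivAt (fun s => u s x) (mcfOp σ (u t) x) t) →
          -- initial condition
          u 0 = u₀ →
          -- uniform spacelikeness: |∇u|²_σ ≤ 1 − μ
          (∀ (t : ℝ), 0 < t → ENNReal.ofReal t < T →
            ∀ x, gradSq σ (u t) x ≤ 1 - μ) →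
          -- conclusions
          (∀ t : ℝ, 0 < t → ENNReal.ofReal t < T →
            ∀ δ : ℝ, 0 < δ →
              ∃ Rδ : ℝ, ∀ x : EuclideanSpace ℝ (Fin n), Rδ ≤ ‖x‖ → |u t x| ≤ δ) ∧
          (∀ t : ℝ, 0 < t → ENNReal.ofReal t < T → ∀ x, |u t x| ≤ b x) := by
  obtain ⟨M, hM⟩ := hbd
  set S : Set (EuclideanSpace ℝ (Fin n) → ℝ) := {f | ∃ (μ t : ℝ)
    (u : ℝ → EuclideanSpace ℝ (Fin n) → ℝ), 0 < μ ∧ 0 < t ∧ IsSpacelikeMCF σ μ t u ∧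
      u 0 = u₀ ∧ f = u t} with hS
  have hSM : ∀ f ∈ S, ∀ x, |f x| ≤ M := by
    rintro _ ⟨μ, t, u, hμ, ht, hu, hu0, rfl⟩ x
    have h1 := hu.le_of_initial_bound hσ hμ (by rw [hu0]; exact hM) t ⟨ht.le, le_rfl⟩ x
    have h2 := hu.neg.le_of_initial_bound hσ hμ (by rw [hu0]; simpa using hM) t ⟨ht.le, le_rfl⟩ x
    rw [abs_le]
    constructor <;> linarith
  have hSδ : ∀ δ : ℝ, 0 < δ → ∃ R : ℝ, ∀ f ∈ S, ∀ x, R ≤ ‖x‖ → |f x| ≤ δ := by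
    intro δ hδ
    obtain ⟨R, hR⟩ := exists_uniform_decay hn hσ hM hdecay hδ
    refine ⟨R, ?_⟩
    rintro _ ⟨μ, t, u, hμ, ht, hu, hu0, rfl⟩ x hx
    exact hR μ t u hμ ht hu hu0 x hx
  obtain ⟨b, hb0, hbδ, hb⟩ := exists_common_barrier hSM hSδ
  refine ⟨b, hb0, hbδ, fun T _ μ hμ u hcont hC2 hder hu0 hgrad => ?_⟩
  have hmem (t : ℝ) (ht : 0 < t) (htT : ENNReal.ofReal t < T) : u t ∈ S := by
    have hlt (s : ℝ) (hs : s ≤ t) : ENNReal.ofReal s < T :=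
      (ENNReal.ofReal_le_ofReal hs).trans_lt htT
    exact ⟨μ, t, u, hμ, ht,
      { continuousOn := hcont.mono (prod_mono_left fun s hs => ⟨hs.1, hlt s hs.2⟩)
        contDiff := fun s h0 h1 => hC2 s h0 (hlt s h1)
        hasDerivAt := fun x s h0 h1 => hder x s h0 (hlt s h1)
        gradSq_le := fun s h0 h1 => hgrad s h0 (hlt s h1) }, hu0, rfl⟩
  refine ⟨fun t ht htT δ hδ => ?_, fun t ht htT x => hb _ (hmem t ht htT) x⟩
  obtain ⟨R, hR⟩ := hSδ δ hδ
  exact ⟨R, fun x hx => hR _ (hmem t ht htT) x hx⟩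
end
end
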